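/- arXiv:1902.06577 — 2 statements merged into one kernel-verified Lean document; each statement's English description precedes it below -/
import Mathlib

section
/- If char(K) = 0 and n = 2a + 1, then the ring R/I^Sp_{(a,a,1)} is Cohen–Macaulay. -/
open MvPolynomial

/-- `T : Fin n → ℕ × ℕ` is a Young tableau of shape given by the list `parts` of row
lengths: `T` is a bijection from `{0, …, n-1}` onto the set of boxes `(r, c)`
(row `r`, column `c`, both 0-indexed) of the Young diagram of `parts`. -/
def IsTableau (parts : List ℕ) {n : ℕ} (T : Fin n → ℕ × ℕ) : Prop :=
  Function.Injective T ∧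
  (∀ i : Fin n, (T i).1 < parts.length ∧ (T i).2 < parts.getD (T i).1 0) ∧
  (∀ r c : ℕ, r < parts.length → c < parts.getD r 0 → ∃ i : Fin n, T i = (r, c))

/-- The Specht polynomial `f_T` of a tableau `T`: the product over all columns `j` of
`∏_{1 ≤ s < t ≤ m} (x_{j_s} - x_{j_t})`, where `j_1, …, j_m` are the entries of column `j`
from top to bottom; equivalently, the product of `X i - X j` over all pairs of entries
`i, j` lying in the same column with `i` strictly above `j`. -/
noncomputable def spechtPoly (K : Type*) [CommRing K] {n : ℕ} (T : Fin n → ℕ × ℕ) :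
    MvPolynomial (Fin n) K :=
  ∏ p ∈ Finset.univ.filter
      (fun p : Fin n × Fin n => (T p.1).2 = (T p.2).2 ∧ (T p.1).1 < (T p.2).1),
    (X p.1 - X p.2)

/-- The Specht ideal of shape `parts`: the ideal of `K[x_1, …, x_n]` generated by all
Specht polynomials of Young tableaux of shape `parts`. -/
noncomputable def spechtIdeal (K : Type*) [CommRing K] (n : ℕ) (parts : List ℕ) :
    Ideal (MvPolynomial (Fin n) K) :=
  Ideal.span {f | ∃ T : Fin n → ℕ × ℕ, IsTableau parts T ∧ f = spechtPoly K T}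

/-- The depth of a (local) commutative ring: the supremum of the lengths of regular
sequences contained in the Jacobson radical (which is the maximal ideal when the ring
is local). -/
noncomputable def ringDepth (A : Type*) [CommRing A] : ℕ∞ :=
  ⨆ rs : {rs : List A // (∀ r ∈ rs, r ∈ (⊥ : Ideal A).jacobson) ∧
      RingTheory.Sequence.IsRegular A rs}, (rs.1.length : ℕ∞)

/-- A commutative ring is Cohen–Macaulay if the localization at every prime ideal has
depth equal to its Krull dimension. -/
def IsCohenMacaulayRing (A : Type*) [CommRing A] : Prop :=
  ∀ (P : Ideal A) [P.IsPrime],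
    (ringDepth (Localization.AtPrime P) : WithBot ℕ∞) = ringKrullDim (Localization.AtPrime P)

open scoped Pointwise

/-- A Noetherian local ring of dimension at least `d` whose maximal ideal is generated by `d`
elements is a domain, and its maximal ideal contains a regular sequence of length `d`. -/
theorem IsLocalRing.isDomain_and_exists_isRegular_of_span_range_eq {d : ℕ} :
    ∀ {A : Type*} [CommRing A] [IsLocalRing A] [IsNoetherianRing A] (f : Fin d → A),
      Ideal.span (Set.range f) = IsLocalRing.maximalIdeal A →
      (d : WithBot ℕ∞) ≤ ringKrullDim A →
      IsDomain A ∧ ∃ rs : List A, rs.length = d ∧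
        (∀ r ∈ rs, r ∈ IsLocalRing.maximalIdeal A) ∧ RingTheory.Sequence.IsRegular A rs := by
  induction d with
  | zero =>
    intro A _ _ _ f hf _
    have hbot : IsLocalRing.maximalIdeal A = ⊥ := by simp [← hf]
    have hF : IsField A := IsLocalRing.isField_iff_maximalIdeal_eq.2 hbot
    exact ⟨hF.isDomain, [], rfl, by simp, RingTheory.Sequence.IsRegular.nil A A⟩
  | succ d ih =>
    intro A _ _ _ f hf hd
    set m := IsLocalRing.maximalIdeal A with hm
    have hm2 : ¬ m ≤ m ^ 2 := by
      intro h
      have : m = ⊥ := Submodule.eq_bot_of_le_smul_of_le_jacobson_bot m m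
        (IsNoetherian.noetherian _) (by rwa [smul_eq_mul, ← sq])
        (IsLocalRing.maximalIdeal_le_jacobson _)
      have hF : IsField A := IsLocalRing.isField_iff_maximalIdeal_eq.2 this
      have h0 := ringKrullDim_eq_zero_of_isField hF
      rw [h0] at hd
      exact absurd hd (by exact_mod_cast Nat.not_succ_le_zero d)
    have hfin := Ideal.finite_minimalPrimes_of_isNoetherianRing A ⊥
    obtain ⟨x, hxm, hx⟩ : ∃ x ∈ m, x ∉ m ^ 2 ∧ ∀ p ∈ minimalPrimes A, x ∉ p := by
      by_contra! hcon
      have hsub : (m : Set A) ⊆ ⋃ i ∈ (↑(insert (m ^ 2) hfin.toFinset) : Set (Ideal A)),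
          ((fun I : Ideal A => I) i : Set A) := by
        intro y hy
        by_cases h2 : y ∈ m ^ 2
        · exact Set.mem_biUnion (by simp) h2
        · obtain ⟨p, hp, hyp⟩ := hcon y hy h2
          refine Set.mem_biUnion (x := p) ?_ hyp
          simp only [Finset.coe_insert, Set.Finite.coe_toFinset]
          exact Or.inr hp
      classical
      rw [Ideal.subset_union_prime (m ^ 2) (m ^ 2)] at hsub
      · obtain ⟨p, hp, hmp⟩ := hsub
        rw [Finset.mem_insert] at hp
        rcases hp with rfl | hp
        · exact hm2 hmp
        · have hp' : p ∈ minimalPrimes A := by simpa using hp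
          have := hp'.1.1
          have hpm : p = m := le_antisymm (IsLocalRing.le_maximalIdeal this.ne_top) hmp
          have h0 := Ideal.height_eq_zero_iff.2 hp'
          have h1 := IsLocalRing.maximalIdeal_height_eq_ringKrullDim (R := A)
          rw [← hm, ← hpm, h0] at h1
          rw [← h1] at hd
          exact absurd hd (by exact_mod_cast Nat.not_succ_le_zero d)
      · intro i hi hne _
        rw [Finset.mem_insert] at hi
        have hi' : i ∈ minimalPrimes A := by simpa [hne] using hi
        exact hi'.1.1
    obtain ⟨hx2, hxmin⟩ := hx
    obtain ⟨c, hc⟩ := (Ideal.mem_span_range_iff_exists_fun (R := A)).1 (hf ▸ hxm)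
    have hfm : ∀ i, f i ∈ m := fun i => hf ▸ Ideal.subset_span ⟨i, rfl⟩
    obtain ⟨i, hi⟩ : ∃ i, c i ∉ m := by
      by_contra! h
      exact hx2 (hc ▸ Ideal.sum_mem _ fun i _ => sq m ▸ Ideal.mul_mem_mul (h i) (hfm i))
    have hiu : IsUnit (c i) := by simpa [hm] using hi
    let B := A ⧸ Ideal.span {x}
    have hne : Ideal.span {x} ≠ ⊤ := fun h =>
      (IsLocalRing.maximalIdeal.isMaximal A).ne_top
        (top_le_iff.1 (h ▸ (Ideal.span_singleton_le_iff_mem _).2 hxm))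
    have : Nontrivial B := Ideal.Quotient.nontrivial_iff.2 hne
    have : IsLocalRing B :=
      IsLocalRing.of_surjective' (Ideal.Quotient.mk (Ideal.span {x})) Ideal.Quotient.mk_surjective
    let π : A →+* B := Ideal.Quotient.mk (Ideal.span {x})
    have hπ : Function.Surjective π := Ideal.Quotient.mk_surjective
    have hmap : IsLocalRing.maximalIdeal B = m.map π :=
      (IsLocalRing.map_maximalIdeal_of_surjective π hπ).symm
    have hπx : π x = 0 := Ideal.Quotient.eq_zero_iff_mem.2 (Ideal.mem_span_singleton_self x)
    have hspan : Ideal.span (Set.range (π ∘ f ∘ i.succAbove)) = IsLocalRing.maximalIdeal B := by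
      rw [hmap, ← hf, Ideal.map_span]
      apply le_antisymm
      · rw [Ideal.span_le]
        rintro _ ⟨j, rfl⟩
        exact Ideal.subset_span ⟨_, ⟨_, rfl⟩, rfl⟩
      · rw [Ideal.span_le]
        rintro _ ⟨_, ⟨j, rfl⟩, rfl⟩
        induction j using i.succAboveCases with
        | x =>
          have h := congrArg π hc
          rw [hπx, map_sum, Fin.sum_univ_succAbove _ i] at h
          have h' : π (c i) * π (f i) ∈ Ideal.span (Set.range (π ∘ f ∘ i.succAbove)) := by
            rw [← map_mul, eq_neg_of_add_eq_zero_left h]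
            refine neg_mem (Ideal.sum_mem _ fun j _ => ?_)
            rw [map_mul]
            exact Ideal.mul_mem_left _ _ (Ideal.subset_span ⟨j, rfl⟩)
          exact (Ideal.unit_mul_mem_iff_mem _ (hiu.map π)).1 h'
        | p j => exact Ideal.subset_span ⟨j, rfl⟩
    have hdim : (d : WithBot ℕ∞) ≤ ringKrullDim B := by
      have h1 := ringKrullDim_le_ringKrullDim_quotSMulTop_succ (R := A) hxm
      have h2 : Ideal.span {x} = x • (⊤ : Ideal A) := by
        simp [← Submodule.ideal_span_singleton_smul]
      rw [← ringKrullDim_eq_of_ringEquiv (Ideal.quotientEquivAlgOfEq A h2).toRingEquiv] at h1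
      have h3 := hd.trans h1
      push_cast at h3
      exact ENat.WithBot.add_le_add_one_right_iff.1 h3
    obtain ⟨hB, rs, hlen, hrs, hreg⟩ := ih (π ∘ f ∘ i.succAbove) hspan hdim
    have hprime : (Ideal.span {x}).IsPrime := (Ideal.Quotient.isDomain_iff_prime _).1 hB
    have hdom : IsDomain A := by
      obtain ⟨q, hq, hqx⟩ := Ideal.exists_minimalPrimes_le (I := (⊥ : Ideal A))
        (J := Ideal.span {x})
        bot_le
      have hqp : q.IsPrime := hq.1.1
      have hxq : x ∉ q := hxmin q hq
      have : q = ⊥ := by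
        refine Submodule.eq_bot_of_le_smul_of_le_jacobson_bot (Ideal.span {x}) q
          (IsNoetherian.noetherian _) ?_ ?_
        · intro y hy
          obtain ⟨z, rfl⟩ := Ideal.mem_span_singleton'.1 (hqx hy)
          have hz : z ∈ q := (hqp.mem_or_mem hy).resolve_right hxq
          rw [mul_comm]
          exact Ideal.mul_mem_mul (Ideal.mem_span_singleton_self x) hz
        · exact ((Ideal.span_singleton_le_iff_mem _).2 hxm).trans
            (IsLocalRing.maximalIdeal_le_jacobson _)
      rw [this] at hqp
      exact IsDomain.of_bot_isPrime A
    refine ⟨hdom, ?_⟩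
    have hx0 : x ≠ 0 := fun h => hx2 (h ▸ zero_mem _)
    choose g hg using hπ
    have hgm : ∀ b ∈ IsLocalRing.maximalIdeal B, g b ∈ m := by
      intro b hb
      by_contra hc
      have hu : IsUnit (g b) := by simpa [hm] using hc
      have := hu.map π
      rw [hg] at this
      exact (IsLocalRing.mem_maximalIdeal b).1 hb this
    refine ⟨x :: rs.map g, by simp [hlen], ?_, ?_⟩
    · simp only [List.mem_cons, List.mem_map]
      rintro r (rfl | ⟨b, hb, rfl⟩)
      · exact hxm
      · exact hgm b (hrs b hb)
    · rw [IsLocalRing.isRegular_iff_isWeaklyRegular_of_subset_maximalIdeal]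
      · rw [RingTheory.Sequence.isWeaklyRegular_cons_iff]
        refine ⟨(IsRegular.of_ne_zero hx0).left.isSMulRegular, ?_⟩
        rw [LinearEquiv.isWeaklyRegular_congr (M₂ := B) (Submodule.quotEquivOfEq _ _
          (show x • (⊤ : Ideal A) = Ideal.span {x} by
            simp [← Submodule.ideal_span_singleton_smul])),
          ← RingTheory.Sequence.isWeaklyRegular_map_algebraMap_iff B B]
        have : (rs.map g).map (algebraMap A B) = rs := by
          rw [List.map_map]
          exact (List.map_congr_left fun b _ => hg b).trans (List.map_id _)
        rw [this]
        exact hreg.toIsWeaklyRegular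
      · simp only [List.mem_cons, List.mem_map]
        rintro r (rfl | ⟨b, hb, rfl⟩)
        · exact hxm
        · exact hgm b (hrs b hb)

theorem IsRegularLocalRing.exists_isRegular_length_eq (A : Type*) [CommRing A]
    [IsRegularLocalRing A] {d : ℕ} (hd : ringKrullDim A = d) :
    ∃ rs : List A, rs.length = d ∧ (∀ r ∈ rs, r ∈ IsLocalRing.maximalIdeal A) ∧
      RingTheory.Sequence.IsRegular A rs := by
  have hfr : (IsLocalRing.maximalIdeal A).spanFinrank = d := by
    have h := IsRegularLocalRing.spanFinrank_maximalIdeal (R := A)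
    rw [hd] at h
    exact_mod_cast h
  obtain ⟨s, hs, hspan⟩ := Submodule.FG.exists_span_finset_card_eq_spanFinrank
    (IsNoetherian.noetherian (IsLocalRing.maximalIdeal A))
  rw [hfr] at hs
  refine (IsLocalRing.isDomain_and_exists_isRegular_of_span_range_eq
    (fun i : Fin d => ((s.equivFinOfCardEq hs).symm i : A)) ?_ hd.ge).2
  rw [← hspan]
  congr 1
  ext x
  constructor
  · rintro ⟨i, rfl⟩
    exact ((s.equivFinOfCardEq hs).symm i).2
  · intro hx
    exact ⟨s.equivFinOfCardEq hs ⟨x, hx⟩, by simp⟩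

/-- A finite flat algebra over a regular ring is Cohen–Macaulay. -/
theorem IsCohenMacaulayRing.of_finite_of_flat (S A : Type*) [CommRing S] [IsRegularRing S]
    [CommRing A] [Algebra S A] [Module.Finite S A] [Module.Flat S A] :
    IsCohenMacaulayRing A := by
  intro P _
  let p := P.under S
  have : P.LiesOver p := ⟨rfl⟩
  have hA : IsNoetherianRing A := IsNoetherianRing.of_finite S A
  let AP := Localization.AtPrime P
  let Sp := Localization.AtPrime p
  let : Algebra Sp AP := Localization.AtPrime.algebraOfLiesOver p P
  have : IsNoetherianRing AP := IsLocalization.isNoetherianRing P.primeCompl _ hA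
  have hflat : Module.Flat Sp AP := inferInstance
  have hjac : (⊥ : Ideal AP).jacobson = IsLocalRing.maximalIdeal AP :=
    IsLocalRing.jacobson_eq_maximalIdeal _ bot_ne_top
  apply le_antisymm
  · obtain ⟨k, hk⟩ : ∃ k : ℕ∞, ringKrullDim AP = k := by
      obtain ⟨k, hk⟩ := WithBot.ne_bot_iff_exists.1 (ringKrullDim_ne_bot (R := AP))
      exact ⟨k, hk.symm⟩
    rw [hk, WithBot.coe_le_coe, ringDepth]
    refine iSup_le fun rs => ?_
    have h := ringKrullDim_add_length_eq_ringKrullDim_of_isRegular rs.1 rs.2.2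
    have hnt : Nontrivial (AP ⧸ Ideal.ofList rs.1) := by
      have := rs.2.2.top_ne_smul
      apply Ideal.Quotient.nontrivial_iff.2
      intro h
      exact this (by simp [h])
    have h0 : 0 ≤ ringKrullDim (AP ⧸ Ideal.ofList rs.1) := ringKrullDim_nonneg_of_nontrivial
    rw [hk] at h
    rw [← WithBot.coe_le_coe, ← h]
    exact le_add_of_nonneg_left h0
  · have hle : P.height ≤ p.height := by
      have := Algebra.IsIntegral.of_finite S A
      have h := Order.height_le_height_apply_of_strictMono
        (PrimeSpectrum.comap (algebraMap S A))
        (fun I J h => Ideal.IsIntegral.comap_lt_comap (R := S) h) ⟨P, ‹_›⟩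
      rwa [← PrimeSpectrum.height_eq_orderHeight, ← PrimeSpectrum.height_eq_orderHeight] at h
    obtain ⟨d, hd⟩ : ∃ d : ℕ, p.height = d := by
      obtain ⟨d, hd⟩ := ENat.ne_top_iff_exists.1 (Ideal.height_ne_top (I := p)
        Ideal.IsPrime.ne_top')
      exact ⟨d, hd.symm⟩
    have hdim : ringKrullDim Sp = d := by
      rw [IsLocalization.AtPrime.ringKrullDim_eq_height p Sp, hd]; rfl
    obtain ⟨rs, hlen, hmem, hreg⟩ := IsRegularLocalRing.exists_isRegular_length_eq Sp hdim
    rw [IsLocalization.AtPrime.ringKrullDim_eq_height P AP, WithBot.coe_le_coe]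
    refine (hle.trans_eq hd).trans ?_
    have hm : ∀ r ∈ rs.map (algebraMap Sp AP), r ∈ IsLocalRing.maximalIdeal AP := by
      intro r hr
      obtain ⟨r', hr', rfl⟩ := List.mem_map.1 hr
      exact (IsLocalRing.mem_maximalIdeal _).2 (map_nonunit (algebraMap Sp AP) r' (hmem r' hr'))
    refine le_trans ?_ (le_iSup _ ⟨rs.map (algebraMap Sp AP), ?_, ?_⟩)
    · simp [hlen]
    · rwa [hjac]
    · rw [IsLocalRing.isRegular_iff_isWeaklyRegular_of_subset_maximalIdeal hm]
      exact hreg.toIsWeaklyRegular.of_flat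

/-- An algebra over a domain `S` spanned by at most as many elements as it has `S`-points is
free and finite. -/
theorem Module.free_and_finite_of_card_le_card_algHom {S A ι κ : Type*} [CommRing S] [IsDomain S]
    [CommRing A] [Algebra S A] [Fintype ι] [Fintype κ] (ρ : ι → A →ₐ[S] S)
    (hρ : Function.Injective ρ) (v : κ → A) (hv : ⊤ ≤ Submodule.span S (Set.range v))
    (hcard : Fintype.card κ ≤ Fintype.card ι) : Module.Free S A ∧ Module.Finite S A := by
  classical
  let L := FractionRing S
  have hinj : Function.Injective (algebraMap S L) := IsFractionRing.injective S L
  let φ : A →ₗ[S] (ι → L) :=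
    LinearMap.pi fun i => (Algebra.linearMap S L) ∘ₗ (ρ i).toLinearMap
  have hφ (a : A) (i : ι) : φ a i = algebraMap S L (ρ i a) := rfl
  have hdual : LinearIndependent L (fun i : ι => fun a : A => φ a i) := by
    let χ : ι → (A →* L) := fun i => ((algebraMap S L).comp (ρ i).toRingHom : A →* L)
    have hχ : Function.Injective χ := by
      intro i j hij
      refine hρ (AlgHom.ext fun a => hinj ?_)
      exact DFunLike.congr_fun hij a
    exact (linearIndependent_monoidHom A L).comp χ hχ
  have hspan : Submodule.span L (Set.range (φ ∘ v)) = ⊤ := by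
    by_contra hne
    obtain ⟨f, hf0, hf⟩ := Submodule.exists_le_ker_of_lt_top _ (lt_top_iff_ne_top.2 hne)
    have hfa (a : A) : f (φ a) = 0 := by
      have ha : a ∈ Submodule.span S (Set.range v) := hv trivial
      induction ha using Submodule.span_induction with
      | mem x hx =>
        obtain ⟨k, rfl⟩ := hx
        exact hf (Submodule.subset_span ⟨k, rfl⟩)
      | zero => simp
      | add x y _ _ hx hy => rw [map_add, map_add, hx, hy, add_zero]
      | smul c x _ hx =>
        rw [map_smul, ← algebraMap_smul L c (φ x), map_smul, hx, smul_zero]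
    have hzero := Fintype.linearIndependent_iff.1 hdual (fun i => f (Pi.single i 1)) (by
      ext a
      have h := hfa a
      rw [pi_eq_sum_univ' (φ a), map_sum] at h
      simp only [Finset.sum_apply, Pi.smul_apply, smul_eq_mul, Pi.zero_apply]
      rw [← h]
      refine Finset.sum_congr rfl fun i _ => ?_
      rw [map_smul, smul_eq_mul, mul_comm])
    apply hf0
    ext i
    simpa using hzero i
  have hfin : Fintype.card κ = Module.finrank L (ι → L) := by
    refine le_antisymm (by simpa using hcard) ?_
    have h := finrank_range_le_card (R := L) (φ ∘ v)
    rwa [Set.finrank, hspan, finrank_top] at h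
  have hli : LinearIndependent L (φ ∘ v) :=
    linearIndependent_of_top_le_span_of_card_eq_finrank hspan.ge hfin
  have hliS : LinearIndependent S v := by
    refine LinearIndependent.of_comp φ (hli.restrict_scalars ?_)
    intro a b hab
    apply hinj
    simpa [Algebra.smul_def] using hab
  let b := Module.Basis.mk hliS hv
  exact ⟨Module.Free.of_basis b, Module.Finite.of_basis b⟩

section SquarefreeForms

variable {ι : Type*} (K : Type*) [Field K]

/-- The derivation `∑ ∂/∂xᵢ`, the infinitesimal generator of simultaneous translation. -/
noncomputable def translationDeriv (ι : Type*) :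
    Derivation K (MvPolynomial ι K) (MvPolynomial ι K) :=
  mkDerivation K fun _ => 1

/-- The squarefree forms of degree `s` in the variables indexed by `N`. -/
noncomputable def squarefreeForms (N : Finset ι) (s : ℕ) : Submodule K (MvPolynomial ι K) :=
  Submodule.span K {f | ∃ S ⊆ N, S.card = s ∧ f = ∏ i ∈ S, X i}

variable {K}

@[simp]
theorem translationDeriv_X (i : ι) : translationDeriv K ι (X i) = 1 :=
  mkDerivation_X _ _ _

theorem translationDeriv_X_mul (i : ι) (f : MvPolynomial ι K) :
    translationDeriv K ι (X i * f) = X i * translationDeriv K ι f + f := by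
  simp [Derivation.leibniz]

theorem iterate_translationDeriv_X_mul (k : ℕ) (i : ι) (f : MvPolynomial ι K) :
    (translationDeriv K ι)^[k + 1] (X i * f) =
      X i * (translationDeriv K ι)^[k + 1] f +
        ((k + 1 : ℕ) : K) • (translationDeriv K ι)^[k] f := by
  induction k with
  | zero => simp
  | succ k ih =>
    rw [Function.iterate_succ_apply', ih, map_add, Derivation.map_smul, translationDeriv_X_mul,
      ← Function.iterate_succ_apply' (translationDeriv K ι) (k + 1),
      ← Function.iterate_succ_apply' (translationDeriv K ι) k, add_assoc]
    congr 1
    rw [Nat.cast_succ (k + 1), add_smul, one_smul, add_comm]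

theorem translationDeriv_mem_supported {s : Set ι} {f : MvPolynomial ι K}
    (hf : f ∈ supported K s) : translationDeriv K ι f ∈ supported K s := by
  induction hf using Algebra.adjoin_induction with
  | mem x hx =>
    obtain ⟨i, _, rfl⟩ := hx
    simp [one_mem]
  | algebraMap r => simp [zero_mem]
  | add x y _ _ hx hy => rw [map_add]; exact add_mem hx hy
  | mul x y hx' hy' hx hy =>
    rw [Derivation.leibniz]
    exact add_mem (mul_mem hx' hy) (mul_mem hy' hx)

theorem iterate_translationDeriv_mem_supported {s : Set ι} {f : MvPolynomial ι K}
    (hf : f ∈ supported K s) (k : ℕ) : (translationDeriv K ι)^[k] f ∈ supported K s := by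
  induction k with
  | zero => exact hf
  | succ k ih =>
    rw [Function.iterate_succ_apply']
    exact translationDeriv_mem_supported ih

theorem eq_zero_of_X_mul_add_eq_zero {s : Set ι} {p : ι} (hp : p ∉ s) {f g : MvPolynomial ι K}
    (hg : g ∈ supported K s) (h : X p * f + g = 0) : f = 0 ∧ g = 0 := by
  classical
  have hg0 : g = 0 := by
    have h1 := congrArg (aeval fun i => if i = p then (0 : MvPolynomial ι K) else X i) h
    have h2 : aeval (fun i => if i = p then (0 : MvPolynomial ι K) else X i) g = g := by
      clear h h1
      induction hg using Algebra.adjoin_induction with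
      | mem x hx =>
        obtain ⟨i, hi, rfl⟩ := hx
        simp [show i ≠ p from fun h => hp (h ▸ hi)]
      | algebraMap r => simp
      | add x y _ _ hx hy => rw [map_add, hx, hy]
      | mul x y _ _ hx hy => rw [map_mul, hx, hy]
    rw [map_add, map_mul, h2, aeval_X, if_pos rfl, zero_mul, zero_add, map_zero] at h1
    exact h1
  refine ⟨?_, hg0⟩
  rw [hg0, add_zero] at h
  exact (mul_eq_zero.1 h).resolve_left (X_ne_zero p)

theorem prod_X_mem_squarefreeForms {N S : Finset ι} (h : S ⊆ N) :
    ∏ i ∈ S, (X i : MvPolynomial ι K) ∈ squarefreeForms K N S.card :=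
  Submodule.subset_span ⟨S, h, rfl, rfl⟩

theorem squarefreeForms_mono {M N : Finset ι} (h : M ⊆ N) (s : ℕ) :
    squarefreeForms K M s ≤ squarefreeForms K N s :=
  Submodule.span_mono fun _ ⟨S, hS, hc, hf⟩ => ⟨S, hS.trans h, hc, hf⟩

theorem squarefreeForms_le_supported (N : Finset ι) (s : ℕ) :
    squarefreeForms K N s ≤ Subalgebra.toSubmodule (supported K (N : Set ι)) := by
  refine Submodule.span_le.2 ?_
  rintro _ ⟨S, hS, -, rfl⟩
  exact prod_mem (S := supported K (N : Set ι)) fun i hi =>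
    Algebra.subset_adjoin ⟨i, hS hi, rfl⟩

theorem squarefreeForms_zero (N : Finset ι) :
    squarefreeForms K N 0 = Submodule.span K {1} := by
  apply le_antisymm <;> refine Submodule.span_mono ?_
  · rintro _ ⟨S, -, hS, rfl⟩
    simp [Finset.card_eq_zero.1 hS]
  · rintro _ rfl
    exact ⟨∅, by simp⟩

theorem squarefreeForms_eq_bot {N : Finset ι} {s : ℕ} (h : N.card < s) :
    squarefreeForms K N s = ⊥ := by
  rw [squarefreeForms, Submodule.span_eq_bot]
  rintro _ ⟨S, hS, hc, -⟩
  have := Finset.card_le_card hS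
  omega

theorem isHomogeneous_of_mem_squarefreeForms {N : Finset ι} {s : ℕ} {f : MvPolynomial ι K}
    (hf : f ∈ squarefreeForms K N s) : f.IsHomogeneous s := by
  rw [← mem_homogeneousSubmodule]
  revert f
  change squarefreeForms K N s ≤ _
  refine Submodule.span_le.2 ?_
  rintro _ ⟨S, -, rfl, rfl⟩
  simpa using! IsHomogeneous.prod S _ _ fun i _ => isHomogeneous_X K i

theorem translationDeriv_eq_zero_of_mem_squarefreeForms_zero {N : Finset ι}
    {f : MvPolynomial ι K} (hf : f ∈ squarefreeForms K N 0) : translationDeriv K ι f = 0 := by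
  rw [squarefreeForms_zero] at hf
  obtain ⟨c, rfl⟩ := Submodule.mem_span_singleton.1 hf
  simp

variable [DecidableEq ι]

theorem X_mul_mem_squarefreeForms {N : Finset ι} {p : ι} (hp : p ∉ N) {s : ℕ}
    {f : MvPolynomial ι K} (hf : f ∈ squarefreeForms K N s) :
    X p * f ∈ squarefreeForms K (insert p N) (s + 1) := by
  revert f
  change squarefreeForms K N s ≤
    (squarefreeForms K (insert p N) (s + 1)).comap (LinearMap.mulLeft K (X p))
  refine Submodule.span_le.2 ?_
  rintro _ ⟨S, hS, rfl, rfl⟩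
  have hpS : p ∉ S := fun h => hp (hS h)
  refine Submodule.subset_span ⟨insert p S, Finset.insert_subset_insert p hS, ?_, ?_⟩
  · exact Finset.card_insert_of_notMem hpS
  · simp [Finset.prod_insert hpS]

theorem exists_eq_X_mul_add_of_mem_squarefreeForms {N : Finset ι} {p : ι} {s : ℕ}
    {f : MvPolynomial ι K} (hf : f ∈ squarefreeForms K (insert p N) (s + 1)) :
    ∃ u ∈ squarefreeForms K N s, ∃ w ∈ squarefreeForms K N (s + 1), f = X p * u + w := by
  have hle : squarefreeForms K (insert p N) (s + 1) ≤
      (squarefreeForms K N s).map (LinearMap.mulLeft K (X p)) ⊔ squarefreeForms K N (s + 1) := by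
    refine Submodule.span_le.2 ?_
    rintro _ ⟨S, hS, hc, rfl⟩
    by_cases hp : p ∈ S
    · refine Submodule.mem_sup_left ⟨∏ i ∈ S.erase p, X i, Submodule.subset_span
        ⟨_, Finset.subset_insert_iff.1 hS, ?_, rfl⟩, ?_⟩
      · rw [Finset.card_erase_of_mem hp, hc]; rfl
      · exact Finset.mul_prod_erase S _ hp
    · exact Submodule.mem_sup_right (Submodule.subset_span
        ⟨S, (Finset.subset_insert_iff_of_notMem hp).1 hS, hc, rfl⟩)
  obtain ⟨_, ⟨u, hu, rfl⟩, w, hw, rfl⟩ := Submodule.mem_sup.1 (hle hf)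
  exact ⟨u, hu, w, hw, rfl⟩

theorem translationDeriv_prod_X (S : Finset ι) :
    translationDeriv K ι (∏ i ∈ S, X i) = ∑ i ∈ S, ∏ j ∈ S.erase i, X j := by
  induction S using Finset.induction_on with
  | empty => simp
  | insert p S hp ih =>
    rw [Finset.prod_insert hp, translationDeriv_X_mul, ih, Finset.sum_insert hp,
      Finset.erase_insert hp, add_comm, Finset.mul_sum]
    congr 1
    refine Finset.sum_congr rfl fun i hi => ?_
    have hpi : p ≠ i := fun h => hp (h ▸ hi)
    rw [Finset.erase_insert_of_ne hpi,
      Finset.prod_insert fun h => hp (Finset.mem_of_mem_erase h)]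

theorem translationDeriv_mem_squarefreeForms {N : Finset ι} {s : ℕ} {f : MvPolynomial ι K}
    (hf : f ∈ squarefreeForms K N (s + 1)) :
    translationDeriv K ι f ∈ squarefreeForms K N s := by
  revert f
  change squarefreeForms K N (s + 1) ≤
    (squarefreeForms K N s).comap (translationDeriv K ι).toLinearMap
  refine Submodule.span_le.2 ?_
  rintro _ ⟨S, hS, hc, rfl⟩
  change translationDeriv K ι _ ∈ squarefreeForms K N s
  rw [translationDeriv_prod_X]
  refine Submodule.sum_mem _ fun i hi => Submodule.subset_span
    ⟨S.erase i, (Finset.erase_subset _ _).trans hS, ?_, rfl⟩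
  rw [Finset.card_erase_of_mem hi, hc]; rfl

variable [CharZero K]

/-- The `k`-th power of the translation derivation is injective on squarefree forms of large
degree. -/
theorem eq_zero_of_iterate_translationDeriv_eq_zero {N : Finset ι} {s k : ℕ}
    {f : MvPolynomial ι K} (hf : f ∈ squarefreeForms K N s) (hk : N.card + k ≤ 2 * s)
    (h : (translationDeriv K ι)^[k] f = 0) : f = 0 := by
  induction N using Finset.induction_on generalizing s k f with
  | empty =>
    rcases s.eq_zero_or_pos with rfl | hs
    · obtain rfl : k = 0 := by simpa using hk
      exact h
    · rw [squarefreeForms_eq_bot (by simpa using hs)] at hf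
      exact (Submodule.mem_bot K).1 hf
  | insert p N hp ih =>
    rw [Finset.card_insert_of_notMem hp] at hk
    obtain ⟨s, rfl⟩ : ∃ t, s = t + 1 := ⟨s - 1, by omega⟩
    obtain _ | k := k
    · exact h
    obtain ⟨u, hu, w, hw, rfl⟩ := exists_eq_X_mul_add_of_mem_squarefreeForms hf
    have hc : ((k + 1 : ℕ) : K) ≠ 0 := Nat.cast_ne_zero.2 k.succ_ne_zero
    have hus := squarefreeForms_le_supported _ _ hu
    have hws := squarefreeForms_le_supported _ _ hw
    rw [iterate_map_add, iterate_translationDeriv_X_mul, add_assoc] at h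
    have hsupp : ((k + 1 : ℕ) : K) • (translationDeriv K ι)^[k] u +
        (translationDeriv K ι)^[k + 1] w ∈ supported K (N : Set ι) :=
      add_mem (Subalgebra.smul_mem _ (iterate_translationDeriv_mem_supported hus k) _)
        (iterate_translationDeriv_mem_supported hws (k + 1))
    obtain ⟨h1, h2⟩ := eq_zero_of_X_mul_add_eq_zero hp hsupp h
    have h3 : (translationDeriv K ι)^[k + 2] w = 0 := by
      have := congrArg (translationDeriv K ι) h2
      rwa [map_add, Derivation.map_smul, ← Function.iterate_succ_apply' (translationDeriv K ι) k,
        h1, smul_zero, zero_add, map_zero,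
        ← Function.iterate_succ_apply' (translationDeriv K ι) (k + 1)] at this
    obtain rfl : w = 0 := ih hw (by omega) h3
    have h4 : (translationDeriv K ι)^[k] u = 0 := by
      rw [iterate_map_zero, add_zero] at h2
      exact (smul_eq_zero.1 h2).resolve_left hc
    rw [ih hu (by omega) h4, mul_zero, zero_add]

/-- The `k`-th power of the translation derivation is surjective onto squarefree forms of small
degree. -/
theorem exists_iterate_translationDeriv_eq {N : Finset ι} {s k : ℕ} {f : MvPolynomial ι K}
    (hf : f ∈ squarefreeForms K N s) (hk : 2 * s + k ≤ N.card) :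
    ∃ g ∈ squarefreeForms K N (s + k), (translationDeriv K ι)^[k] g = f := by
  induction N using Finset.induction_on generalizing s k f with
  | empty =>
    obtain ⟨rfl, rfl⟩ : s = 0 ∧ k = 0 := by simp at hk; omega
    exact ⟨f, hf, rfl⟩
  | insert p N hp ih =>
    rw [Finset.card_insert_of_notMem hp] at hk
    obtain _ | k := k
    · exact ⟨f, hf, rfl⟩
    have hc : ((k + 1 : ℕ) : K) ≠ 0 := Nat.cast_ne_zero.2 k.succ_ne_zero
    obtain _ | s := s
    · have hf' : ((k + 1 : ℕ) : K)⁻¹ • f ∈ squarefreeForms K N 0 := by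
        rw [squarefreeForms_zero] at hf ⊢
        exact Submodule.smul_mem _ _ hf
      obtain ⟨g, hg, hgf⟩ := ih (k := k) hf' (by omega)
      refine ⟨X p * g, X_mul_mem_squarefreeForms hp hg, ?_⟩
      rw [iterate_translationDeriv_X_mul, Function.iterate_succ_apply', hgf, Derivation.map_smul,
        translationDeriv_eq_zero_of_mem_squarefreeForms_zero hf, smul_zero, mul_zero, zero_add,
        smul_inv_smul₀ hc]
    · obtain ⟨u, hu, w, hw, rfl⟩ := exists_eq_X_mul_add_of_mem_squarefreeForms hf
      obtain ⟨β, hβ, hβu⟩ := ih (s := s) (k := k + 2)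
        (f := translationDeriv K ι w - ((k + 1 : ℕ) : K) • u)
        (sub_mem (translationDeriv_mem_squarefreeForms hw) (Submodule.smul_mem _ _ hu)) (by omega)
      have hmem : ∀ j t, ∀ g ∈ squarefreeForms K N (t + j),
          (translationDeriv K ι)^[j] g ∈ squarefreeForms K N t := by
        intro j
        induction j with
        | zero => exact fun t g hg => hg
        | succ j ihj =>
          intro t g hg
          rw [Function.iterate_succ_apply']
          exact translationDeriv_mem_squarefreeForms (ihj (t + 1) g (by convert hg using 2; ring))
      obtain ⟨α, hα, hαw⟩ := ih (s := s + 1) (k := k)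
        (f := ((k + 1 : ℕ) : K)⁻¹ • (w - (translationDeriv K ι)^[k + 1] β))
        (Submodule.smul_mem _ _ (sub_mem hw
          (hmem (k + 1) (s + 1) β (by convert hβ using 2; ring)))) (by omega)
      refine ⟨X p * α + β, add_mem ?_ ?_, ?_⟩
      · exact X_mul_mem_squarefreeForms hp hα
      · refine squarefreeForms_mono (Finset.subset_insert _ _) _ ?_
        convert hβ using 2
        ring
      · have h1 : (translationDeriv K ι)^[k + 1] α = u := by
          rw [Function.iterate_succ_apply', hαw, Derivation.map_smul, map_sub,
            ← Function.iterate_succ_apply' (translationDeriv K ι) (k + 1), hβu, sub_sub_cancel,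
            inv_smul_smul₀ hc]
        rw [iterate_map_add, iterate_translationDeriv_X_mul, h1, hαw, smul_inv_smul₀ hc]
        ring

end SquarefreeForms

section PairForms

variable {ι : Type*} {K : Type*} [Field K]

theorem pderiv_eq_zero_of_mem_squarefreeForms {N : Finset ι} {s : ℕ} {p : ι} (hp : p ∉ N)
    {f : MvPolynomial ι K} (hf : f ∈ squarefreeForms K N s) : pderiv p f = 0 := by
  have h : (f.vars : Set ι) ⊆ N := mem_supported.1 (squarefreeForms_le_supported _ _ hf)
  exact pderiv_eq_zero_of_notMem_vars fun hpf => hp (by simpa using h hpf)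

theorem translationDeriv_X_sq_mul (i : ι) (g : MvPolynomial ι K) :
    translationDeriv K ι (X i ^ 2 * g) = X i ^ 2 * translationDeriv K ι g + X i * (2 * g) := by
  rw [pow_two, mul_assoc, translationDeriv_X_mul, translationDeriv_X_mul]
  ring

theorem two_mul_mem {P : Submodule K (MvPolynomial ι K)} {g : MvPolynomial ι K} (hg : g ∈ P) :
    2 * g ∈ P := by
  rw [two_mul]
  exact add_mem hg hg

variable [DecidableEq ι]

variable (K) in
/-- `PairProd K M s q` says that `q` is a product of `s` differences `X i - X j`, over pairs
`{i, j}` partitioning `M`. -/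
inductive PairProd : Finset ι → ℕ → MvPolynomial ι K → Prop
  | nil : PairProd ∅ 0 1
  | cons {M : Finset ι} {s : ℕ} {q : MvPolynomial ι K} {i j : ι} (hij : i ≠ j) (hi : i ∉ M)
      (hj : j ∉ M) (hq : PairProd M s q) :
      PairProd (insert i (insert j M)) (s + 1) ((X i - X j) * q)

variable (K) in
/-- The span of the products of `s` differences over disjoint pairs of elements of `N`. -/
noncomputable def pairForms (N : Finset ι) (s : ℕ) : Submodule K (MvPolynomial ι K) :=
  Submodule.span K {q | ∃ M ⊆ N, PairProd K M s q}

theorem PairProd.card_eq {M : Finset ι} {s : ℕ} {q : MvPolynomial ι K} (h : PairProd K M s q) :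
    M.card = 2 * s := by
  induction h with
  | nil => rfl
  | cons hij hi hj _ ih =>
    rw [Finset.card_insert_of_notMem (by simp [hij, hi]), Finset.card_insert_of_notMem hj, ih]
    ring

theorem PairProd.translationDeriv_eq_zero {M : Finset ι} {s : ℕ} {q : MvPolynomial ι K}
    (h : PairProd K M s q) : translationDeriv K ι q = 0 := by
  induction h with
  | nil => simp
  | cons hij hi hj _ ih => simp [Derivation.leibniz, ih]

theorem PairProd.mem_squarefreeForms {M : Finset ι} {s : ℕ} {q : MvPolynomial ι K}
    (h : PairProd K M s q) : q ∈ squarefreeForms K M s := by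
  induction h with
  | nil => simpa using prod_X_mem_squarefreeForms (K := K) (Finset.Subset.refl (∅ : Finset ι))
  | @cons M s q i j hij hi hj _ ih =>
    rw [sub_mul]
    refine sub_mem ?_ (squarefreeForms_mono (Finset.subset_insert _ _) _
      (X_mul_mem_squarefreeForms hj ih))
    refine squarefreeForms_mono ?_ _ (X_mul_mem_squarefreeForms hi ih)
    exact Finset.insert_subset_insert _ (Finset.subset_insert _ _)

theorem pairForms_mono {M N : Finset ι} (h : M ⊆ N) (s : ℕ) :
    pairForms K M s ≤ pairForms K N s :=
  Submodule.span_mono fun _ ⟨S, hS, hq⟩ => ⟨S, hS.trans h, hq⟩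

theorem exists_X_mul_add_mem_pairForms {N : Finset ι} {p : ι} (hp : p ∉ N) {s : ℕ}
    (hs : 2 * s < N.card) {u : MvPolynomial ι K} (hu : u ∈ pairForms K N s) :
    ∃ w ∈ squarefreeForms K N (s + 1), X p * u + w ∈ pairForms K (insert p N) (s + 1) := by
  induction hu using Submodule.span_induction with
  | mem q hq =>
    obtain ⟨M, hM, hq⟩ := hq
    obtain ⟨l, hlN, hlM⟩ : ∃ l ∈ N, l ∉ M :=
      Finset.exists_mem_notMem_of_card_lt_card (by rwa [hq.card_eq])
    refine ⟨-(X l * q), neg_mem (squarefreeForms_mono (Finset.insert_subset hlN hM) _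
      (X_mul_mem_squarefreeForms hlM hq.mem_squarefreeForms)), Submodule.subset_span
      ⟨insert p (insert l M), Finset.insert_subset_insert _ (Finset.insert_subset hlN hM), ?_⟩⟩
    rw [← sub_eq_add_neg, ← sub_mul]
    exact .cons (fun h => hp (h ▸ hlN)) (fun h => hp (hM h)) hlM hq
  | zero => exact ⟨0, zero_mem _, by simp⟩
  | add x y _ _ hx hy =>
    obtain ⟨w, hw, h⟩ := hx
    obtain ⟨w', hw', h'⟩ := hy
    refine ⟨w + w', add_mem hw hw', ?_⟩
    convert add_mem h h' using 1
    ring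
  | smul c x _ hx =>
    obtain ⟨w, hw, h⟩ := hx
    refine ⟨c • w, Submodule.smul_mem _ c hw, ?_⟩
    convert Submodule.smul_mem _ c h using 1
    rw [smul_add, mul_smul_comm]

theorem translationDeriv_eq_zero_of_mem_pairForms {N : Finset ι} {s : ℕ}
    {g : MvPolynomial ι K} (hg : g ∈ pairForms K N s) : translationDeriv K ι g = 0 := by
  induction hg using Submodule.span_induction with
  | mem q hq =>
    obtain ⟨M, -, hq⟩ := hq
    exact hq.translationDeriv_eq_zero
  | zero => simp
  | add x y _ _ hx hy => rw [map_add, hx, hy, add_zero]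
  | smul c x _ hx => rw [Derivation.map_smul, hx, smul_zero]

theorem one_mem_pairForms (N : Finset ι) : (1 : MvPolynomial ι K) ∈ pairForms K N 0 :=
  Submodule.subset_span ⟨∅, Finset.empty_subset _, .nil⟩

/-- Translation invariant squarefree forms are spanned by products of differences over disjoint
pairs of variables. -/
theorem mem_pairForms_of_translationDeriv_eq_zero [CharZero K] {N : Finset ι} {s : ℕ}
    {g : MvPolynomial ι K} (hg : g ∈ squarefreeForms K N s) (hD : translationDeriv K ι g = 0) :
    g ∈ pairForms K N s := by
  induction N using Finset.induction_on generalizing s g with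
  | empty =>
    obtain _ | s := s
    · rw [squarefreeForms_zero] at hg
      exact Submodule.span_le.2 (by simpa using one_mem_pairForms _) hg
    · rw [squarefreeForms_eq_bot (by simp), Submodule.mem_bot] at hg
      exact hg ▸ zero_mem _
  | insert p N hp ih =>
    obtain _ | s := s
    · rw [squarefreeForms_zero] at hg
      exact Submodule.span_le.2 (by simpa using one_mem_pairForms _) hg
    by_cases hs : (insert p N).card + 1 ≤ 2 * (s + 1)
    · rw [eq_zero_of_iterate_translationDeriv_eq_zero hg hs hD]
      exact zero_mem _
    rw [Finset.card_insert_of_notMem hp] at hs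
    obtain ⟨u, hu, w, hw, rfl⟩ := exists_eq_X_mul_add_of_mem_squarefreeForms hg
    have hsupp : u + translationDeriv K ι w ∈ supported K (N : Set ι) :=
      add_mem (squarefreeForms_le_supported _ _ hu)
        (translationDeriv_mem_supported (squarefreeForms_le_supported _ _ hw))
    rw [map_add, translationDeriv_X_mul, add_assoc] at hD
    obtain ⟨h1, h2⟩ := eq_zero_of_X_mul_add_eq_zero hp hsupp hD
    obtain ⟨w', hw', h⟩ := exists_X_mul_add_mem_pairForms hp (by omega) (ih hu h1)
    have h3 : w - w' ∈ pairForms K N (s + 1) := by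
      refine ih (sub_mem hw hw') ?_
      have h4 := translationDeriv_eq_zero_of_mem_pairForms h
      rw [map_add, translationDeriv_X_mul, h1, mul_zero, zero_add] at h4
      rw [map_sub, ← sub_eq_zero.2 (h2.trans h4.symm)]
      ring
    convert add_mem h (pairForms_mono (Finset.subset_insert p N) _ h3) using 1
    ring

end PairForms

section SquareForms

variable {ι : Type*} [DecidableEq ι] (K : Type*) [Field K]

/-- The span of the monomials `xᵢ² ∏_{j ∈ A} xⱼ` with `A ⊆ N` of size `s` and `i ∈ N \ A`. -/
noncomputable def squareForms (N : Finset ι) (s : ℕ) : Submodule K (MvPolynomial ι K) :=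
  ⨆ i ∈ N, (squarefreeForms K (N.erase i) s).map (LinearMap.mulLeft K (X i ^ 2))

/-- The span of the products of a Vandermonde product in three variables from `N` with `s`
differences over pairs of the remaining variables from `N`. -/
noncomputable def tripleForms (N : Finset ι) (s : ℕ) : Submodule K (MvPolynomial ι K) :=
  Submodule.span K {f | ∃ M ⊆ N, ∃ q, PairProd K M s q ∧ ∃ i ∈ N, ∃ j ∈ N, ∃ k ∈ N,
    i ∉ M ∧ j ∉ M ∧ k ∉ M ∧ i ≠ j ∧ i ≠ k ∧ j ≠ k ∧
    f = (X i - X j) * (X i - X k) * (X j - X k) * q}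

variable {K}

theorem pderiv_pderiv_eq_zero_of_mem_squarefreeForms {N : Finset ι} {s : ℕ} (p : ι)
    {f : MvPolynomial ι K} (hf : f ∈ squarefreeForms K N s) : pderiv p (pderiv p f) = 0 := by
  by_cases hp : p ∈ N
  · obtain ⟨N, hpN, rfl⟩ : ∃ N', p ∉ N' ∧ N = insert p N' :=
      ⟨N.erase p, by simp, (Finset.insert_erase hp).symm⟩
    obtain _ | s := s
    · rw [squarefreeForms_zero] at hf
      obtain ⟨c, rfl⟩ := Submodule.mem_span_singleton.1 hf
      simp
    obtain ⟨u, hu, w, hw, rfl⟩ := exists_eq_X_mul_add_of_mem_squarefreeForms hf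
    simp [Derivation.leibniz, pderiv_eq_zero_of_mem_squarefreeForms hpN hu,
      pderiv_eq_zero_of_mem_squarefreeForms hpN hw]
  · rw [pderiv_eq_zero_of_mem_squarefreeForms hp hf, map_zero]

theorem X_sq_mul_mem_squareForms {N : Finset ι} {s : ℕ} {i : ι} (hi : i ∈ N)
    {g : MvPolynomial ι K} (hg : g ∈ squarefreeForms K (N.erase i) s) :
    X i ^ 2 * g ∈ squareForms K N s :=
  Submodule.mem_iSup_of_mem i (Submodule.mem_iSup_of_mem hi ⟨g, hg, rfl⟩)

theorem exists_eq_sum_of_mem_squareForms {N : Finset ι} {s : ℕ} {f : MvPolynomial ι K}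
    (hf : f ∈ squareForms K N s) : ∃ g : ι → MvPolynomial ι K,
      (∀ i, g i ∈ squarefreeForms K (N.erase i) s) ∧ f = ∑ i ∈ N, X i ^ 2 * g i := by
  obtain ⟨μ, hμ, rfl⟩ := (Submodule.mem_iSup_finset_iff_exists_sum _ _).1 hf
  choose g hg hgμ using fun i => (μ i).2
  exact ⟨g, hg, Finset.sum_congr rfl fun i _ => (hgμ i).symm⟩

theorem eq_zero_of_sum_X_sq_mul_add_eq_zero [CharZero K] {N : Finset ι} {s t : ℕ}
    {a : ι → MvPolynomial ι K} (ha : ∀ i, a i ∈ squarefreeForms K (N.erase i) s)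
    {b : MvPolynomial ι K} (hb : b ∈ squarefreeForms K N t)
    (h : ∑ i ∈ N, X i ^ 2 * a i + b = 0) {p : ι} (hp : p ∈ N) : a p = 0 := by
  have h1 := congrArg (fun f => pderiv p (pderiv p f)) h
  have hap : pderiv p (a p) = 0 := pderiv_eq_zero_of_mem_squarefreeForms (by simp) (ha p)
  have hi : ∀ i ∈ N.erase p, pderiv p (pderiv p (X i ^ 2 * a i)) = 0 := by
    intro i hi
    have hip : i ≠ p := Finset.ne_of_mem_erase hi
    simp [Derivation.leibniz, Derivation.leibniz_pow, pderiv_X_of_ne hip,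
      pderiv_pderiv_eq_zero_of_mem_squarefreeForms p (ha i)]
  have hpp : pderiv p (pderiv p (X p ^ 2 * a p)) = 2 * a p := by
    have h2 : pderiv p (2 : MvPolynomial ι K) = 0 := by exact_mod_cast (pderiv p).map_natCast 2
    simp [Derivation.leibniz, Derivation.leibniz_pow, hap, h2]
    ring
  simp only [map_add, map_zero, pderiv_pderiv_eq_zero_of_mem_squarefreeForms p hb, add_zero] at h1
  rw [← Finset.add_sum_erase _ _ hp, map_add, map_add, hpp, map_sum, map_sum,
    Finset.sum_eq_zero hi, add_zero] at h1
  exact (mul_eq_zero.1 h1).resolve_left two_ne_zero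

theorem sum_X_mul_mem_squarefreeForms {N : Finset ι} {s : ℕ} {g : ι → MvPolynomial ι K}
    (hg : ∀ i, g i ∈ squarefreeForms K (N.erase i) s) :
    ∑ i ∈ N, X i * (2 * g i) ∈ squarefreeForms K N (s + 1) := by
  refine Submodule.sum_mem _ fun i hi => ?_
  have := X_mul_mem_squarefreeForms (Finset.notMem_erase i N) (two_mul_mem (hg i))
  rwa [Finset.insert_erase hi] at this

theorem eq_zero_of_mem_squareForms_zero [CharZero K] {N : Finset ι} {f : MvPolynomial ι K}
    (hf : f ∈ squareForms K N 0) (hD : translationDeriv K ι f = 0) : f = 0 := by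
  obtain ⟨g, hg, rfl⟩ := exists_eq_sum_of_mem_squareForms hf
  have hg' : ∀ i p, pderiv p (g i) = 0 := by
    intro i p
    have := hg i
    rw [squarefreeForms_zero] at this
    obtain ⟨c, hc⟩ := Submodule.mem_span_singleton.1 this
    simp [← hc]
  refine Finset.sum_eq_zero fun p hp => ?_
  simp only [map_sum, translationDeriv_X_sq_mul,
    translationDeriv_eq_zero_of_mem_squarefreeForms_zero (hg _), mul_zero, zero_add] at hD
  have h1 := congrArg (pderiv p) hD
  rw [← Finset.add_sum_erase _ _ hp, map_add, map_sum, Finset.sum_eq_zero, map_zero] at h1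
  · rw [Derivation.leibniz, two_mul, map_add, hg'] at h1
    simp [← two_mul] at h1
    rw [h1, mul_zero]
  · intro i hi
    rw [two_mul, Derivation.leibniz, map_add, hg', pderiv_X_of_ne (Finset.ne_of_mem_erase hi)]
    simp

theorem exists_eq_of_mem_squareForms {N : Finset ι} {p : ι} (hp : p ∉ N) {s : ℕ}
    {f : MvPolynomial ι K} (hf : f ∈ squareForms K (insert p N) (s + 1)) :
    ∃ g ∈ squarefreeForms K N (s + 1), ∃ f₁ ∈ squareForms K N s,
      ∃ f₀ ∈ squareForms K N (s + 1), f = X p ^ 2 * g + X p * f₁ + f₀ := by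
  obtain ⟨g, hg, rfl⟩ := exists_eq_sum_of_mem_squareForms hf
  have h1 : ∀ i ∈ N, ∃ u ∈ squarefreeForms K (N.erase i) s,
      ∃ w ∈ squarefreeForms K (N.erase i) (s + 1), g i = X p * u + w := by
    intro i hi
    have := hg i
    rw [Finset.erase_insert_of_ne fun h : p = i => hp (h ▸ hi)] at this
    exact exists_eq_X_mul_add_of_mem_squarefreeForms this
  choose! u hu w hw huw using h1
  refine ⟨g p, by simpa [Finset.erase_insert hp] using hg p, ∑ i ∈ N, X i ^ 2 * u i,
    Submodule.sum_mem _ fun i hi => X_sq_mul_mem_squareForms hi (hu i hi), ∑ i ∈ N, X i ^ 2 * w i,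
    Submodule.sum_mem _ fun i hi => X_sq_mul_mem_squareForms hi (hw i hi), ?_⟩
  rw [Finset.sum_insert hp, add_assoc, Finset.mul_sum, ← Finset.sum_add_distrib]
  congr 1
  refine Finset.sum_congr rfl fun i hi => ?_
  rw [huw i hi]
  ring

theorem vandermonde_mul_mem_squareForms {M N : Finset ι} (hM : M ⊆ N) {s : ℕ}
    {q : MvPolynomial ι K} (hq : q ∈ squarefreeForms K M s) {i j k : ι} (hi : i ∈ N) (hj : j ∈ N)
    (hk : k ∈ N) (hiM : i ∉ M) (hjM : j ∉ M) (hkM : k ∉ M) (hij : i ≠ j) (hik : i ≠ k)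
    (hjk : j ≠ k) :
    (X i - X j) * (X i - X k) * (X j - X k) * q ∈ squareForms K N (s + 1) := by
  have key : ∀ {a b : ι}, a ∈ N → b ∈ N → a ∉ M → b ∉ M → a ≠ b →
      X a ^ 2 * (X b * q) ∈ squareForms K N (s + 1) := by
    intro a b ha hb haM hbM hab
    refine X_sq_mul_mem_squareForms ha (squarefreeForms_mono ?_ _
      (X_mul_mem_squarefreeForms hbM hq))
    refine Finset.insert_subset (Finset.mem_erase.2 ⟨hab.symm, hb⟩) fun x hx => ?_
    exact Finset.mem_erase.2 ⟨fun h => haM (h ▸ hx), hM hx⟩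
  convert add_mem (sub_mem (sub_mem (key hi hj hiM hjM hij) (key hi hk hiM hkM hik))
    (sub_mem (key hj hi hjM hiM hij.symm) (key hj hk hjM hkM hjk)))
    (sub_mem (key hk hi hkM hiM hik.symm) (key hk hj hkM hjM hjk.symm)) using 1
  ring

theorem translationDeriv_eq_zero_of_mem_tripleForms {N : Finset ι} {s : ℕ}
    {f : MvPolynomial ι K} (hf : f ∈ tripleForms K N s) : translationDeriv K ι f = 0 := by
  induction hf using Submodule.span_induction with
  | mem f hf =>
    obtain ⟨M, -, q, hq, i, -, j, -, k, -, -, -, -, -, -, -, rfl⟩ := hf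
    simp [Derivation.leibniz, hq.translationDeriv_eq_zero]
  | zero => simp
  | add x y _ _ hx hy => rw [map_add, hx, hy, add_zero]
  | smul c x _ hx => rw [Derivation.map_smul, hx, smul_zero]

theorem tripleForms_mono {M N : Finset ι} (h : M ⊆ N) (s : ℕ) :
    tripleForms K M s ≤ tripleForms K N s := by
  refine Submodule.span_mono ?_
  rintro _ ⟨S, hS, q, hq, i, hi, j, hj, k, hk, hf⟩
  exact ⟨S, hS.trans h, q, hq, i, h hi, j, h hj, k, h hk, hf⟩

theorem exists_X_sq_mul_add_mem_tripleForms {N : Finset ι} {p : ι} (hp : p ∉ N) {s : ℕ}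
    {g : MvPolynomial ι K} (hg : g ∈ pairForms K N (s + 1)) :
    ∃ f₁ ∈ squareForms K N s, ∃ f₀ ∈ squareForms K N (s + 1),
      X p ^ 2 * g + X p * f₁ + f₀ ∈ tripleForms K (insert p N) s := by
  induction hg using Submodule.span_induction with
  | mem q hq =>
    obtain ⟨M, hM, hq⟩ := hq
    obtain _ | @⟨M, _, q, i, j, hij, hi, hj, hq⟩ := hq
    obtain ⟨hiN, hM⟩ := Finset.insert_subset_iff.1 hM
    obtain ⟨hjN, hM⟩ := Finset.insert_subset_iff.1 hM
    have hpi : p ≠ i := fun h => hp (h ▸ hiN)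
    have hpj : p ≠ j := fun h => hp (h ▸ hjN)
    have hsub : ∀ {a : ι}, a ∉ M → M ⊆ N.erase a := fun ha x hx =>
      Finset.mem_erase.2 ⟨fun h => ha (h ▸ hx), hM hx⟩
    have hsub' : ∀ {a b : ι}, a ∉ M → b ∈ N → b ≠ a → insert b M ⊆ N.erase a :=
      fun ha hb hab => Finset.insert_subset (Finset.mem_erase.2 ⟨hab, hb⟩) (hsub ha)
    refine ⟨X j ^ 2 * q - X i ^ 2 * q, sub_mem ?_ ?_,
      X i ^ 2 * (X j * q) - X j ^ 2 * (X i * q), sub_mem ?_ ?_, Submodule.subset_span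
      ⟨M, hM.trans (Finset.subset_insert _ _), q, hq, p, by simp, i, by simp [hiN], j,
        by simp [hjN], fun h => hp (hM h), hi, hj, hpi, hpj, hij, by ring⟩⟩
    · exact X_sq_mul_mem_squareForms hjN (squarefreeForms_mono (hsub hj) _ hq.mem_squarefreeForms)
    · exact X_sq_mul_mem_squareForms hiN (squarefreeForms_mono (hsub hi) _ hq.mem_squarefreeForms)
    · exact X_sq_mul_mem_squareForms hiN (squarefreeForms_mono (hsub' hi hjN hij.symm) _
        (X_mul_mem_squarefreeForms hj hq.mem_squarefreeForms))
    · exact X_sq_mul_mem_squareForms hjN (squarefreeForms_mono (hsub' hj hiN hij) _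
        (X_mul_mem_squarefreeForms hi hq.mem_squarefreeForms))
  | zero => exact ⟨0, zero_mem _, 0, zero_mem _, by simp⟩
  | add x y _ _ hx hy =>
    obtain ⟨u, hu, w, hw, h⟩ := hx
    obtain ⟨u', hu', w', hw', h'⟩ := hy
    refine ⟨u + u', add_mem hu hu', w + w', add_mem hw hw', ?_⟩
    convert add_mem h h' using 1
    ring
  | smul c x _ hx =>
    obtain ⟨u, hu, w, hw, h⟩ := hx
    refine ⟨c • u, Submodule.smul_mem _ c hu, c • w, Submodule.smul_mem _ c hw, ?_⟩
    convert Submodule.smul_mem _ c h using 1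
    rw [smul_add, smul_add, mul_smul_comm, mul_smul_comm]

theorem exists_X_mul_add_mem_tripleForms {N : Finset ι} {p : ι} (hp : p ∉ N) {s : ℕ}
    (hs : 2 * s + 3 < N.card) {f : MvPolynomial ι K} (hf : f ∈ tripleForms K N s) :
    ∃ f₀ ∈ squareForms K N (s + 2), X p * f + f₀ ∈ tripleForms K (insert p N) (s + 1) := by
  induction hf using Submodule.span_induction with
  | mem f hf =>
    obtain ⟨M, hM, q, hq, i, hi, j, hj, k, hk, hiM, hjM, hkM, hij, hik, hjk, rfl⟩ := hf
    obtain ⟨l, hlN, hl⟩ : ∃ l ∈ N, l ∉ insert i (insert j (insert k M)) := by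
      refine Finset.exists_mem_notMem_of_card_lt_card (lt_of_le_of_lt ?_ hs)
      have h1 := Finset.card_insert_le i (insert j (insert k M))
      have h2 := Finset.card_insert_le j (insert k M)
      have h3 := Finset.card_insert_le k M
      have := hq.card_eq
      omega
    simp only [Finset.mem_insert, not_or] at hl
    obtain ⟨hli, hlj, hlk, hlM⟩ := hl
    have hp' : ∀ {x}, x ∈ N → x ≠ p := fun hx h => hp (h ▸ hx)
    refine ⟨-((X i - X j) * (X i - X k) * (X j - X k) * (X l * q)), neg_mem
      (vandermonde_mul_mem_squareForms (Finset.insert_subset hlN hM)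
        (X_mul_mem_squarefreeForms hlM hq.mem_squarefreeForms) hi hj hk
        (by simp [hiM, Ne.symm hli]) (by simp [hjM, Ne.symm hlj]) (by simp [hkM, Ne.symm hlk])
        hij hik hjk), Submodule.subset_span ⟨insert p (insert l M),
        Finset.insert_subset_insert _ (Finset.insert_subset hlN hM), (X p - X l) * q,
        .cons (hp' hlN).symm (fun h => hp (hM h)) hlM hq, i, by simp [hi], j, by simp [hj], k,
        by simp [hk], by simp [hiM, Ne.symm hli, hp' hi], by simp [hjM, Ne.symm hlj, hp' hj],
        by simp [hkM, Ne.symm hlk, hp' hk], hij, hik, hjk, by ring⟩⟩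
  | zero => exact ⟨0, zero_mem _, by simp⟩
  | add x y _ _ hx hy =>
    obtain ⟨w, hw, h⟩ := hx
    obtain ⟨w', hw', h'⟩ := hy
    refine ⟨w + w', add_mem hw hw', ?_⟩
    convert add_mem h h' using 1
    ring
  | smul c x _ hx =>
    obtain ⟨w, hw, h⟩ := hx
    refine ⟨c • w, Submodule.smul_mem _ c hw, ?_⟩
    convert Submodule.smul_mem _ c h using 1
    rw [smul_add, mul_smul_comm]

theorem squareForms_le_supported (N : Finset ι) (s : ℕ) :
    squareForms K N s ≤ Subalgebra.toSubmodule (supported K (N : Set ι)) := by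
  intro f hf
  obtain ⟨g, hg, rfl⟩ := exists_eq_sum_of_mem_squareForms hf
  refine sum_mem (S := supported K (N : Set ι)) fun i hi => mul_mem (pow_mem ?_ 2) ?_
  · exact Algebra.subset_adjoin ⟨i, hi, rfl⟩
  · exact squarefreeForms_le_supported N s (squarefreeForms_mono (Finset.erase_subset i N) s (hg i))

theorem peel_translationDeriv_eq_zero {N : Finset ι} {p : ι} (hp : p ∉ N) {s t : ℕ}
    {g f₁ f₀ : MvPolynomial ι K} (hg : g ∈ squarefreeForms K N t) (hf₁ : f₁ ∈ squareForms K N s)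
    (hf₀ : f₀ ∈ squareForms K N t)
    (h : translationDeriv K ι (X p ^ 2 * g + X p * f₁ + f₀) = 0) :
    translationDeriv K ι g = 0 ∧ 2 * g + translationDeriv K ι f₁ = 0 ∧
      f₁ + translationDeriv K ι f₀ = 0 := by
  have hf₁' := squareForms_le_supported _ _ hf₁
  have hg' := squarefreeForms_le_supported _ _ (two_mul_mem hg)
  rw [map_add, map_add, translationDeriv_X_sq_mul, translationDeriv_X_mul] at h
  have h1 : f₁ + translationDeriv K ι f₀ ∈ supported K (N : Set ι) :=
    add_mem hf₁' (translationDeriv_mem_supported (squareForms_le_supported _ _ hf₀))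
  have h2 : 2 * g + translationDeriv K ι f₁ ∈ supported K (N : Set ι) :=
    add_mem hg' (translationDeriv_mem_supported hf₁')
  obtain ⟨h3, h4⟩ := eq_zero_of_X_mul_add_eq_zero hp h1
    (f := X p * translationDeriv K ι g + (2 * g + translationDeriv K ι f₁))
    (by rw [← h]; ring)
  obtain ⟨h5, h6⟩ := eq_zero_of_X_mul_add_eq_zero hp h2 h3
  exact ⟨h5, h6, h4⟩

/-- Translation invariant elements of `squareForms` are spanned by products of a Vandermonde
product in three variables and differences over disjoint pairs of the remaining variables. -/
theorem mem_tripleForms_of_translationDeriv_eq_zero [CharZero K] {N : Finset ι} {s : ℕ}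
    {f : MvPolynomial ι K} (hf : f ∈ squareForms K N (s + 1)) (hD : translationDeriv K ι f = 0) :
    f ∈ tripleForms K N s := by
  induction N using Finset.induction_on generalizing s f with
  | empty =>
    obtain ⟨g, -, rfl⟩ := exists_eq_sum_of_mem_squareForms hf
    simp
  | insert p N hp ih =>
    by_cases hs : (insert p N).card ≤ 2 * (s + 1)
    · obtain ⟨g, hg, rfl⟩ := exists_eq_sum_of_mem_squareForms hf
      rw [Finset.sum_eq_zero fun i hi => ?_]
      · exact zero_mem _
      simp only [map_sum, translationDeriv_X_sq_mul, Finset.sum_add_distrib] at hD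
      have h := eq_zero_of_sum_X_sq_mul_add_eq_zero
        (fun i => translationDeriv_mem_squarefreeForms (hg i))
        (sum_X_mul_mem_squarefreeForms hg) hD hi
      rw [eq_zero_of_iterate_translationDeriv_eq_zero (k := 1) (hg i) ?_ h, mul_zero]
      rw [Finset.card_erase_of_mem hi]
      have := Finset.card_pos.2 ⟨i, hi⟩
      omega
    rw [Finset.card_insert_of_notMem hp] at hs
    obtain ⟨g, hg, f₁, hf₁, f₀, hf₀, rfl⟩ := exists_eq_of_mem_squareForms hp hf
    obtain ⟨u₁, hu₁, u₀, hu₀, hu⟩ := exists_X_sq_mul_add_mem_tripleForms hp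
      (mem_pairForms_of_translationDeriv_eq_zero hg
        (peel_translationDeriv_eq_zero hp hg hf₁ hf₀ hD).1)
    have hD' : translationDeriv K ι (X p ^ 2 * 0 + X p * (f₁ - u₁) + (f₀ - u₀)) = 0 := by
      have h : X p ^ 2 * 0 + X p * (f₁ - u₁) + (f₀ - u₀) =
          (X p ^ 2 * g + X p * f₁ + f₀) - (X p ^ 2 * g + X p * u₁ + u₀) := by ring
      rw [h, map_sub, hD, translationDeriv_eq_zero_of_mem_tripleForms hu, sub_zero]
    have hf₁' := sub_mem hf₁ hu₁
    have hf₀' := sub_mem hf₀ hu₀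
    obtain ⟨-, h1, h2⟩ :=
      peel_translationDeriv_eq_zero hp (zero_mem (squarefreeForms K N (s + 1))) hf₁' hf₀' hD'
    rw [mul_zero, zero_add] at h1
    obtain ⟨w, hw, h3⟩ : ∃ w ∈ squareForms K N (s + 1),
        X p * (f₁ - u₁) + w ∈ tripleForms K (insert p N) s := by
      obtain _ | s := s
      · rw [eq_zero_of_mem_squareForms_zero hf₁' h1]
        exact ⟨0, zero_mem _, by simp⟩
      · exact exists_X_mul_add_mem_tripleForms hp (by omega) (ih hf₁' h1)
    have h4 : (f₀ - u₀) - w ∈ tripleForms K N s := by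
      refine ih (sub_mem hf₀' hw) ?_
      have h5 := translationDeriv_eq_zero_of_mem_tripleForms h3
      rw [map_add, translationDeriv_X_mul, h1, mul_zero, zero_add] at h5
      rw [map_sub, ← sub_eq_zero.2 (h2.trans h5.symm)]
      ring
    convert add_mem hu (add_mem h3 (tripleForms_mono (Finset.subset_insert p N) s h4)) using 1
    ring

end SquareForms

section PolarForms

variable {ι : Type*} {K : Type*} [Field K]

variable (K) in
/-- The span of the products of a variable from `N` and a squarefree form of degree `s` in the
variables from `N`. -/
noncomputable def polarForms (N : Finset ι) (s : ℕ) : Submodule K (MvPolynomial ι K) :=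
  Submodule.span K {f | ∃ i ∈ N, ∃ g ∈ squarefreeForms K N s, f = X i * g}

theorem mul_mem_polarForms {N : Finset ι} {s : ℕ} {i : ι} (hi : i ∈ N) {g : MvPolynomial ι K}
    (hg : g ∈ squarefreeForms K N s) : X i * g ∈ polarForms K N s :=
  Submodule.subset_span ⟨i, hi, g, hg, rfl⟩

theorem isHomogeneous_of_mem_polarForms {N : Finset ι} {s : ℕ} {f : MvPolynomial ι K}
    (hf : f ∈ polarForms K N s) : f.IsHomogeneous (s + 1) := by
  rw [← mem_homogeneousSubmodule]
  revert f
  change polarForms K N s ≤ _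
  refine Submodule.span_le.2 ?_
  rintro _ ⟨i, -, g, hg, rfl⟩
  rw [add_comm]
  exact (isHomogeneous_X K i).mul (isHomogeneous_of_mem_squarefreeForms hg)

variable [DecidableEq ι]

theorem polarForms_le (N : Finset ι) (s : ℕ) :
    polarForms K N (s + 1) ≤ squareForms K N s ⊔ squarefreeForms K N (s + 2) := by
  refine Submodule.span_le.2 ?_
  rintro _ ⟨i, hi, g, hg, rfl⟩
  rw [← Finset.insert_erase hi] at hg
  obtain ⟨u, hu, w, hw, rfl⟩ := exists_eq_X_mul_add_of_mem_squarefreeForms hg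
  refine Submodule.mem_sup.2 ⟨X i ^ 2 * u, X_sq_mul_mem_squareForms hi hu, X i * w, ?_, by ring⟩
  have := X_mul_mem_squarefreeForms (Finset.notMem_erase i N) hw
  rwa [Finset.insert_erase hi] at this

theorem mem_tripleForms_of_mem_polarForms [CharZero K] {N : Finset ι} {s : ℕ}
    (hs : N.card ≤ 2 * s + 3) {f : MvPolynomial ι K} (hf : f ∈ polarForms K N (s + 2))
    (hD : translationDeriv K ι f = 0) : f ∈ tripleForms K N s := by
  obtain ⟨f', hf', b, hb, rfl⟩ := Submodule.mem_sup.1 (polarForms_le _ _ hf)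
  have hb0 : b = 0 := by
    obtain ⟨g, hg, rfl⟩ := exists_eq_sum_of_mem_squareForms hf'
    simp only [map_add, map_sum, translationDeriv_X_sq_mul, Finset.sum_add_distrib] at hD
    rw [add_assoc] at hD
    have h1 := fun i hi => eq_zero_of_sum_X_sq_mul_add_eq_zero (p := i)
      (fun i => translationDeriv_mem_squarefreeForms (hg i))
      (add_mem (sum_X_mul_mem_squarefreeForms hg) (translationDeriv_mem_squarefreeForms hb)) hD hi
    have h2 : ∑ i ∈ N, X i * (2 * g i) + translationDeriv K ι b = 0 := by
      rwa [Finset.sum_eq_zero fun i hi => by rw [h1 i hi, mul_zero], zero_add] at hD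
    have h3 := congrArg (fun f => translationDeriv K ι (translationDeriv K ι f)) h2
    simp only [map_add, map_sum, map_zero, translationDeriv_X_mul] at h3
    refine eq_zero_of_iterate_translationDeriv_eq_zero hb (k := 3) (by omega) ?_
    rw [Finset.sum_eq_zero fun i hi => ?_, zero_add] at h3
    · exact h3
    · simp [two_mul, h1 i hi]
  rw [hb0, add_zero] at hD ⊢
  exact mem_tripleForms_of_translationDeriv_eq_zero hf' hD

theorem squarefreeForms_le_polarForms (N : Finset ι) (s : ℕ) :
    squarefreeForms K N (s + 1) ≤ polarForms K N s := by
  refine Submodule.span_le.2 ?_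
  rintro _ ⟨S, hS, hc, rfl⟩
  obtain ⟨i, hi⟩ : S.Nonempty := Finset.card_pos.1 (by omega)
  rw [← Finset.mul_prod_erase S _ hi]
  refine mul_mem_polarForms (hS hi) (Submodule.subset_span
    ⟨S.erase i, (Finset.erase_subset _ _).trans hS, ?_, rfl⟩)
  rw [Finset.card_erase_of_mem hi, hc]; rfl

theorem translationDeriv_mem_polarForms {N : Finset ι} {s : ℕ} {f : MvPolynomial ι K}
    (hf : f ∈ polarForms K N (s + 1)) : translationDeriv K ι f ∈ polarForms K N s := by
  induction hf using Submodule.span_induction with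
  | mem f hf =>
    obtain ⟨i, hi, g, hg, rfl⟩ := hf
    rw [translationDeriv_X_mul]
    exact add_mem (mul_mem_polarForms hi (translationDeriv_mem_squarefreeForms hg))
      (squarefreeForms_le_polarForms _ _ hg)
  | zero => simp
  | add x y _ _ hx hy => rw [map_add]; exact add_mem hx hy
  | smul c x _ hx => rw [Derivation.map_smul]; exact Submodule.smul_mem _ c hx

end PolarForms

section Tableaux

variable {K : Type*} [Field K] {n : ℕ}

/-- The product of `X x - X y` over the pairs of elements of `M` lying in the same column of `T`,
with `x` above `y`. -/
noncomputable def columnProd (K : Type*) [Field K] (T : Fin n → ℕ × ℕ) (M : Finset (Fin n)) :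
    MvPolynomial (Fin n) K :=
  ∏ x ∈ M, ∏ y ∈ M, if (T x).2 = (T y).2 ∧ (T x).1 < (T y).1 then X x - X y else 1

theorem spechtPoly_eq_columnProd (T : Fin n → ℕ × ℕ) :
    spechtPoly K T = columnProd K T Finset.univ := by
  rw [spechtPoly, columnProd, Finset.prod_filter, ← Finset.univ_product_univ, Finset.prod_product]

theorem columnProd_congr {T T' : Fin n → ℕ × ℕ} {M : Finset (Fin n)} (h : ∀ x ∈ M, T x = T' x) :
    columnProd K T M = columnProd K T' M :=
  Finset.prod_congr rfl fun x hx => Finset.prod_congr rfl fun y hy => by rw [h x hx, h y hy]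

theorem columnProd_disjUnion {T : Fin n → ℕ × ℕ} {M N : Finset (Fin n)} (hd : Disjoint N M)
    (h : ∀ x ∈ M, ∀ y ∈ N, (T x).2 ≠ (T y).2) :
    columnProd K T (N ∪ M) = columnProd K T N * columnProd K T M := by
  rw [columnProd, Finset.prod_union hd]
  congr 1
  · refine Finset.prod_congr rfl fun x hx => ?_
    rw [Finset.prod_union hd, Finset.prod_eq_one (s := M), mul_one]
    exact fun y hy => if_neg fun h' => h y hy x hx h'.1.symm
  · refine Finset.prod_congr rfl fun x hx => ?_
    rw [Finset.prod_union hd, Finset.prod_eq_one (s := N), one_mul]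
    exact fun y hy => if_neg fun h' => h x hx y hy h'.1

theorem PairProd.exists_tableau {M : Finset (Fin n)} {s : ℕ} {q : MvPolynomial (Fin n) K}
    (h : PairProd K M s q) : ∃ T : Fin n → ℕ × ℕ, Set.InjOn T M ∧
      (∀ x ∈ M, (T x).1 < 2 ∧ 1 ≤ (T x).2 ∧ (T x).2 ≤ s) ∧
      (∀ r c, r < 2 → 1 ≤ c → c ≤ s → ∃ x ∈ M, T x = (r, c)) ∧ columnProd K T M = q := by
  induction h with
  | nil => exact ⟨fun _ => (0, 0), by simp, by simp, by intros; omega, by simp [columnProd]⟩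
  | @cons M s q i j hij hi hj _ ih =>
    obtain ⟨T, hT, hM, hs, hq⟩ := ih
    let T' : Fin n → ℕ × ℕ := fun x => if x = i then (0, s + 1) else
      if x = j then (1, s + 1) else T x
    have hTi : T' i = (0, s + 1) := if_pos rfl
    have hTj : T' j = (1, s + 1) := by simp [T', hij.symm]
    have hTM : ∀ x ∈ M, T' x = T x := by
      intro x hx
      have h1 : x ≠ i := fun h => hi (h ▸ hx)
      have h2 : x ≠ j := fun h => hj (h ▸ hx)
      simp [T', h1, h2]
    have hcol : ∀ x ∈ M, (T' x).2 ≠ s + 1 := fun x hx => by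
      have := (hM x hx).2.2
      rw [hTM x hx]
      omega
    refine ⟨T', ?_, ?_, ?_, ?_⟩
    · rw [Finset.coe_insert, Finset.coe_insert, Set.injOn_insert (by simp [hij, hi]),
        Set.injOn_insert (by simpa using hj)]
      refine ⟨⟨fun x hx y hy hxy => hT hx hy ?_, ?_⟩, ?_⟩
      · rwa [hTM x hx, hTM y hy] at hxy
      · rintro ⟨x, hx, hxj⟩
        exact hcol x hx (by rw [hxj, hTj])
      · rintro ⟨x, hx, hxi⟩
        rcases hx with rfl | hx
        · simp [hTi, hTj] at hxi
        · exact hcol x hx (by rw [hxi, hTi])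
    · intro x hx
      simp only [Finset.mem_insert] at hx
      rcases hx with rfl | rfl | hx
      · simp [hTi]
      · simp [hTj]
      · rw [hTM x hx]
        have := hM x hx
        omega
    · intro r c hr hc hcs
      rcases Nat.lt_or_ge s c with h | h
      · obtain rfl : c = s + 1 := by omega
        rcases (by omega : r = 0 ∨ r = 1) with rfl | rfl
        · exact ⟨i, by simp, hTi⟩
        · exact ⟨j, by simp, hTj⟩
      · obtain ⟨x, hx, hxT⟩ := hs r c hr hc h
        exact ⟨x, by simp [hx], by rw [hTM x hx, hxT]⟩
    · have h1 : insert i (insert j M) = ({i, j} : Finset (Fin n)) ∪ M := by ext; simp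
      rw [h1, columnProd_disjUnion, columnProd_congr hTM, hq]
      · simp [columnProd, Finset.prod_insert, hij, hTi, hTj]
      · simp [hi, hj]
      · intro x hx y hy
        simp only [Finset.mem_insert, Finset.mem_singleton] at hy
        rcases hy with rfl | rfl
        · rw [hTi]; exact hcol x hx
        · rw [hTj]; exact hcol x hx

theorem tripleForms_le_spechtIdeal (n a : ℕ) (hn : n = 2 * a + 3) :
    tripleForms K (Finset.univ : Finset (Fin n)) a ≤
      (spechtIdeal K n [a + 1, a + 1, 1]).restrictScalars K := by
  refine Submodule.span_le.2 ?_
  rintro _ ⟨M, -, q, hq, i, -, j, -, k, -, hiM, hjM, hkM, hij, hik, hjk, rfl⟩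
  obtain ⟨T, hT, hM, hs, hTq⟩ := hq.exists_tableau
  have hdisj : Disjoint ({i, j, k} : Finset (Fin n)) M := by simp [hiM, hjM, hkM]
  have huniv : ({i, j, k} : Finset (Fin n)) ∪ M = Finset.univ := by
    apply Finset.eq_univ_of_card
    rw [Finset.card_union_of_disjoint hdisj, hq.card_eq, Fintype.card_fin,
      Finset.card_eq_three.2 ⟨i, j, k, hij, hik, hjk, rfl⟩]
    omega
  let T' : Fin n → ℕ × ℕ := fun x =>
    if x = i then (0, 0) else if x = j then (1, 0) else if x = k then (2, 0) else T x
  have hTi : T' i = (0, 0) := if_pos rfl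
  have hTj : T' j = (1, 0) := by simp [T', hij.symm]
  have hTk : T' k = (2, 0) := by simp [T', hik.symm, hjk.symm]
  have hTM : ∀ x ∈ M, T' x = T x := by
    intro x hx
    have h1 : x ≠ i := fun h => hiM (h ▸ hx)
    have h2 : x ≠ j := fun h => hjM (h ▸ hx)
    have h3 : x ≠ k := fun h => hkM (h ▸ hx)
    simp [T', h1, h2, h3]
  have hcol : ∀ x ∈ M, (T' x).2 ≠ 0 := fun x hx => by
    have := (hM x hx).2.1
    rw [hTM x hx]
    omega
  have hcases : ∀ x, x = i ∨ x = j ∨ x = k ∨ x ∈ M := by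
    intro x
    have := Finset.mem_univ x
    rw [← huniv] at this
    simpa [or_assoc] using this
  refine Ideal.subset_span ⟨T', ⟨?_, ?_, ?_⟩, ?_⟩
  · intro x y hxy
    rcases hcases x with rfl | rfl | rfl | hx <;> rcases hcases y with rfl | rfl | rfl | hy <;>
      first
        | rfl
        | exact absurd (by rw [hxy]; simp [hTi, hTj, hTk]) (hcol x ‹_›)
        | exact absurd (by rw [← hxy]; simp [hTi, hTj, hTk]) (hcol y ‹_›)
        | exact hT hx hy (by rwa [hTM x hx, hTM y hy] at hxy)
        | simp [hTi, hTj, hTk] at hxy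
  · intro x
    rcases hcases x with rfl | rfl | rfl | hx
    · simp [hTi]
    · simp [hTj]
    · simp [hTk]
    · obtain ⟨h1, h2, h3⟩ := hM x hx
      rw [hTM x hx]
      refine ⟨by simp; omega, ?_⟩
      rcases (by omega : (T x).1 = 0 ∨ (T x).1 = 1) with h | h <;> rw [h] <;> simp <;> omega
  · intro r c hr hc
    rcases c.eq_zero_or_pos with rfl | hc'
    · rcases (by simp at hr; omega : r = 0 ∨ r = 1 ∨ r = 2) with rfl | rfl | rfl
      · exact ⟨i, hTi⟩
      · exact ⟨j, hTj⟩
      · exact ⟨k, hTk⟩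
    · have : r < 2 ∧ c ≤ a := by
        rcases (by simp at hr; omega : r = 0 ∨ r = 1 ∨ r = 2) with rfl | rfl | rfl <;>
          simp at hc <;> omega
      obtain ⟨x, hx, hxT⟩ := hs r c this.1 hc' this.2
      exact ⟨x, by rw [hTM x hx, hxT]⟩
  · rw [spechtPoly_eq_columnProd, ← huniv, columnProd_disjUnion hdisj, columnProd_congr hTM, hTq]
    · congr 1
      simp [columnProd, Finset.prod_insert, hij, hik, hjk, hTi, hTj, hTk]
    · intro x hx y hy
      simp only [Finset.mem_insert, Finset.mem_singleton] at hy
      rcases hy with rfl | rfl | rfl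
      · rw [hTi]; exact hcol x hx
      · rw [hTj]; exact hcol x hx
      · rw [hTk]; exact hcol x hx

end Tableaux

section MomentCurve

/-- An induction principle for homogeneous polynomials. -/
theorem MvPolynomial.IsHomogeneous.mem_of_X_mul_mem {σ K : Type*} [CommSemiring K]
    {P : ℕ → Submodule K (MvPolynomial σ K)} {D : ℕ} (h1 : 1 ∈ P 0)
    (hX : ∀ d < D, ∀ f ∈ P d, ∀ k, X k * f ∈ P (d + 1)) {d : ℕ} (hd : d ≤ D)
    {f : MvPolynomial σ K} (hf : f.IsHomogeneous d) : f ∈ P d := by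
  have key : ∀ d ≤ D, ∀ m : σ →₀ ℕ, m.degree = d → monomial m (1 : K) ∈ P d := by
    intro d
    induction d with
    | zero =>
      intro _ m hm
      rw [(Finsupp.degree_eq_zero_iff m).1 hm]
      exact h1
    | succ d ih =>
      intro hd m hm
      have hm0 : m ≠ 0 := by rintro rfl; simp at hm
      obtain ⟨k, hk⟩ := Finsupp.ne_iff.1 hm0
      have hle : Finsupp.single k 1 ≤ m :=
        Finsupp.single_le_iff.2 (Nat.one_le_iff_ne_zero.2 hk)
      have hadd : Finsupp.single k 1 + (m - Finsupp.single k 1) = m := add_tsub_cancel_of_le hle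
      have hdeg : (m - Finsupp.single k 1).degree = d := by
        have := congrArg Finsupp.degree hadd
        rw [map_add, Finsupp.degree_single] at this
        omega
      have := hX d hd _ (ih (by omega) _ hdeg) k
      rwa [X, monomial_mul, hadd, one_mul] at this
  rw [f.as_sum]
  refine Submodule.sum_mem _ fun m hm => ?_
  rw [← mul_one (coeff m f), ← smul_eq_mul, ← smul_monomial]
  refine Submodule.smul_mem _ _ (key d hd m ?_)
  rw [Finsupp.degree_eq_weight_one]
  exact hf (mem_support_iff.1 hm)

variable {K : Type*} [Field K] {n : ℕ}

/-- The homomorphism from `K[x₀, …, xₙ₋₁]` to `K[u₀, …, uₘ₋₁]` sending `xᵢ` to the value at `t i`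
of the polynomial with coefficients `u₀, …, uₘ₋₁`. -/
noncomputable def momentHom (t : Fin n → K) (m : ℕ) :
    MvPolynomial (Fin n) K →ₐ[K] MvPolynomial (Fin m) K :=
  aeval fun i => ∑ k : Fin m, t i ^ (k : ℕ) • X k

variable {t : Fin n → K} {m : ℕ}

@[simp]
theorem momentHom_X (i : Fin n) : momentHom t m (X i) = ∑ k : Fin m, t i ^ (k : ℕ) • X k :=
  aeval_X _ _

theorem momentHom_translationDeriv (f : MvPolynomial (Fin n) K) :
    momentHom t (m + 1) (translationDeriv K (Fin n) f) = pderiv 0 (momentHom t (m + 1) f) := by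
  induction f using MvPolynomial.induction_on with
  | C c =>
    rw [← algebraMap_eq, Derivation.map_algebraMap, AlgHom.commutes, Derivation.map_algebraMap,
      map_zero]
  | add f g hf hg => simp only [map_add, hf, hg]
  | mul_X f i hf =>
    have h : pderiv 0 (∑ k : Fin (m + 1), t i ^ (k : ℕ) • (X k : MvPolynomial _ K)) = 1 := by
      rw [map_sum, Fin.sum_univ_succ, Finset.sum_eq_zero]
      · simp
      · intro k _
        rw [Derivation.map_smul, pderiv_X_of_ne (Fin.succ_ne_zero k), smul_zero]
    rw [mul_comm, translationDeriv_X_mul, map_add, map_mul, map_mul, hf, Derivation.leibniz,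
      momentHom_X, h]
    simp

theorem exists_momentHom_eq_X (ht : Function.Injective t) {B : Finset (Fin n)}
    (hB : B.card = m) (k : Fin m) : ∃ y ∈ squarefreeForms K B 1, momentHom t m y = X k := by
  refine ⟨∑ b ∈ B, (Lagrange.basis B t b).coeff k • X b, Submodule.sum_mem _ fun b hb =>
    Submodule.smul_mem _ _ (Submodule.subset_span ⟨{b}, by simpa using hb, by simp⟩), ?_⟩
  have h : ∀ j : Fin m,
      ∑ b ∈ B, (Lagrange.basis B t b).coeff k * t b ^ (j : ℕ) = if j = k then 1 else 0 := by
    intro j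
    have h1 : (Polynomial.X ^ (j : ℕ) : Polynomial K) =
        Lagrange.interpolate B t fun b => t b ^ (j : ℕ) := by
      refine Lagrange.eq_interpolate_of_eval_eq _ ht.injOn ?_ fun b _ => by simp
      rw [Polynomial.degree_X_pow, hB]
      exact_mod_cast j.2
    have h2 := congrArg (fun f => Polynomial.coeff f k) h1
    simp only [Lagrange.interpolate_apply, Polynomial.finsetSum_coeff, Polynomial.coeff_C_mul,
      Polynomial.coeff_X_pow] at h2
    simp only [mul_comm (Polynomial.coeff _ _)]
    rw [← h2]
    simp [Fin.ext_iff, eq_comm]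
  simp only [map_sum, map_smul, momentHom_X, Finset.smul_sum, smul_smul]
  rw [Finset.sum_comm]
  simp only [← Finset.sum_smul, h, ite_smul, one_smul, zero_smul]
  simp

theorem mul_prod_X_mem_squarefreeForms {B S : Finset (Fin n)} (h : Disjoint B S)
    {y : MvPolynomial (Fin n) K} (hy : y ∈ squarefreeForms K B 1) {s : ℕ} (hs : S.card = s) :
    y * ∏ i ∈ S, X i ∈ squarefreeForms K Finset.univ (s + 1) := by
  subst hs
  induction hy using Submodule.span_induction with
  | mem y hy =>
    obtain ⟨A, hA, hAc, rfl⟩ := hy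
    obtain ⟨b, rfl⟩ := Finset.card_eq_one.1 hAc
    rw [Finset.prod_singleton]
    have hb : b ∉ S := Finset.disjoint_left.1 h (hA (by simp))
    exact squarefreeForms_mono (Finset.subset_univ _) _
      (X_mul_mem_squarefreeForms hb (prod_X_mem_squarefreeForms (Finset.Subset.refl S)))
  | zero => simp
  | add x y _ _ hx hy => rw [add_mul]; exact add_mem hx hy
  | smul c x _ hx => rw [smul_mul_assoc]; exact Submodule.smul_mem _ c hx

theorem mem_map_momentHom_squarefreeForms (ht : Function.Injective t) (hn : n + 1 = 2 * m) {d : ℕ}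
    (hd : d ≤ m) {h : MvPolynomial (Fin m) K} (hh : h.IsHomogeneous d) :
    h ∈ (squarefreeForms K Finset.univ d).map (momentHom t m).toLinearMap := by
  refine hh.mem_of_X_mul_mem
    (P := fun d => (squarefreeForms K Finset.univ d).map (momentHom t m).toLinearMap) ?_ ?_ hd
  · exact ⟨1, by rw [squarefreeForms_zero]; exact Submodule.subset_span rfl,
      map_one (momentHom t m)⟩
  · rintro d hd _ ⟨g, hg, rfl⟩ k
    induction hg using Submodule.span_induction with
    | mem g hg =>
      obtain ⟨A, -, hA, rfl⟩ := hg
      obtain ⟨B, hBA, hB⟩ : ∃ B ⊆ Aᶜ, B.card = m := by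
        refine Finset.exists_subset_card_eq ?_
        rw [Finset.card_compl, Fintype.card_fin]
        omega
      obtain ⟨y, hy, hyk⟩ := exists_momentHom_eq_X ht hB k
      refine ⟨y * ∏ i ∈ A, X i, mul_prod_X_mem_squarefreeForms
        (Finset.disjoint_left.2 fun x hx => by simpa using hBA hx) hy hA, ?_⟩
      simp [hyk]
    | zero => simp
    | add x y _ _ hx hy => rw [map_add, mul_add]; exact add_mem hx hy
    | smul c x _ hx => rw [map_smul, mul_smul_comm]; exact Submodule.smul_mem _ c hx

theorem exists_mem_polarForms_momentHom_eq (ht : Function.Injective t) (hn : n + 1 = 2 * m)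
    {h : MvPolynomial (Fin m) K} (hh : h.IsHomogeneous (m + 1)) :
    ∃ f ∈ polarForms K Finset.univ m, momentHom t m f = h := by
  let P : ℕ → Submodule K (MvPolynomial (Fin m) K) := fun d =>
    if d ≤ m then homogeneousSubmodule (Fin m) K d else
      (polarForms K Finset.univ m).map (momentHom t m).toLinearMap
  have hP : h ∈ P (m + 1) := by
    refine hh.mem_of_X_mul_mem (D := m + 1) ?_ ?_ le_rfl
    · rw [show P 0 = _ from if_pos m.zero_le]
      exact isHomogeneous_one (Fin m) K
    · intro d hd f hf k
      have hdm : d ≤ m := by omega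
      simp only [P, if_pos hdm, mem_homogeneousSubmodule] at hf
      rcases hdm.lt_or_eq with hdm' | rfl
      · simp only [P, if_pos (show d + 1 ≤ m from hdm'), mem_homogeneousSubmodule]
        rw [add_comm]
        exact (isHomogeneous_X K k).mul hf
      · simp only [P, if_neg (show ¬d + 1 ≤ d by omega)]
        obtain ⟨g, hg, rfl⟩ := mem_map_momentHom_squarefreeForms ht hn le_rfl hf
        obtain ⟨B, -, hB⟩ := Finset.exists_subset_card_eq
          (s := (Finset.univ : Finset (Fin n))) (n := d) (by simp; omega)
        obtain ⟨y, hy, hyk⟩ := exists_momentHom_eq_X ht hB k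
        refine ⟨y * g, ?_, by simp [hyk]⟩
        clear hyk
        induction hy using Submodule.span_induction with
        | mem y hy =>
          obtain ⟨A, hA, hAc, rfl⟩ := hy
          obtain ⟨b, rfl⟩ := Finset.card_eq_one.1 hAc
          rw [Finset.prod_singleton]
          exact mul_mem_polarForms (Finset.mem_univ b) hg
        | zero => simp
        | add x y _ _ hx hy => rw [add_mul]; exact add_mem hx hy
        | smul c x _ hx => rw [smul_mul_assoc]; exact Submodule.smul_mem _ c hx
  simpa [P] using hP

theorem eq_zero_of_momentHom_eq_zero (ht : Function.Injective t) (hn : n + 1 = 2 * m)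
    {f : MvPolynomial (Fin n) K} (hf : f ∈ squarefreeForms K Finset.univ m)
    (h : momentHom t m f = 0) : f = 0 := by
  have hset : {f : MvPolynomial (Fin n) K | ∃ S ⊆ Finset.univ, S.card = m ∧ f = ∏ i ∈ S, X i} =
      (fun S : Finset (Fin n) => ∏ i ∈ S, X i) ''
        ((Finset.univ : Finset (Fin n)).powersetCard m : Set (Finset (Fin n))) := by
    ext f
    simp [eq_comm]
  rw [squarefreeForms, hset, Submodule.mem_span_image_finset_iff_exists_fun'] at hf
  obtain ⟨c, rfl⟩ := hf
  refine Finset.sum_eq_zero fun S hS => ?_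
  have hSm := (Finset.mem_powersetCard.1 hS).2
  let P : Polynomial K := ∏ i ∈ Sᶜ, (Polynomial.X - Polynomial.C (t i))
  have hPdeg : P.natDegree < m := by
    rw [Polynomial.natDegree_prod_of_monic _ _ fun i _ => Polynomial.monic_X_sub_C _]
    simp only [Polynomial.natDegree_X_sub_C, Finset.sum_const, smul_eq_mul, mul_one]
    rw [Finset.card_compl, Fintype.card_fin]
    omega
  have hev : ∀ i, eval (fun k : Fin m => P.coeff k) (momentHom t m (X i)) = P.eval (t i) := by
    intro i
    rw [momentHom_X, map_sum, Polynomial.eval_eq_sum_range' hPdeg, ← Fin.sum_univ_eq_sum_range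
      (fun k => P.coeff k * t i ^ k)]
    refine Finset.sum_congr rfl fun k _ => ?_
    rw [smul_eval, eval_X, mul_comm]
  have hP0 : ∀ i, P.eval (t i) = 0 ↔ i ∉ S := by
    intro i
    simp only [P, Polynomial.eval_prod, Finset.prod_eq_zero_iff, Polynomial.eval_sub,
      Polynomial.eval_X, Polynomial.eval_C, sub_eq_zero, ht.eq_iff]
    simp
  have h1 := congrArg (eval fun k : Fin m => P.coeff k) h
  simp only [map_sum, map_smul, map_prod, smul_eval, hev, map_zero] at h1
  rw [Finset.sum_eq_single_of_mem S hS] at h1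
  · rw [(mul_eq_zero.1 h1).resolve_right, zero_smul]
    exact Finset.prod_ne_zero_iff.2 fun i hi h => (hP0 i).1 h hi
  · intro S' hS' hne
    obtain ⟨i, hi, hiS⟩ : ∃ i ∈ S', i ∉ S := by
      by_contra! hsub
      exact hne (Finset.eq_of_subset_of_card_le hsub
        (by rw [hSm, (Finset.mem_powersetCard.1 hS').2]))
    rw [Finset.prod_eq_zero hi ((hP0 i).2 hiS), mul_zero]

theorem exists_sub_translationDeriv_mem_squarefreeForms [CharZero K] (ht : Function.Injective t)
    (hn : n = 2 * m + 1) {y : MvPolynomial (Fin n) K} (hy : y ∈ polarForms K Finset.univ m) :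
    ∃ g ∈ polarForms K Finset.univ (m + 1), momentHom t (m + 1) g = 0 ∧
      y - translationDeriv K (Fin n) g ∈ squarefreeForms K Finset.univ (m + 1) := by
  have hadd : ∀ x y : MvPolynomial (Fin n) K,
      (∃ g ∈ polarForms K Finset.univ (m + 1), momentHom t (m + 1) g = 0 ∧
        x - translationDeriv K (Fin n) g ∈ squarefreeForms K Finset.univ (m + 1)) →
      (∃ g ∈ polarForms K Finset.univ (m + 1), momentHom t (m + 1) g = 0 ∧
        y - translationDeriv K (Fin n) g ∈ squarefreeForms K Finset.univ (m + 1)) →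
      ∃ g ∈ polarForms K Finset.univ (m + 1), momentHom t (m + 1) g = 0 ∧
        x + y - translationDeriv K (Fin n) g ∈ squarefreeForms K Finset.univ (m + 1) := by
    rintro x y ⟨g, hg, hg0, h⟩ ⟨g', hg', hg0', h'⟩
    refine ⟨g + g', add_mem hg hg', by rw [map_add, hg0, hg0', add_zero], ?_⟩
    rw [map_add, add_sub_add_comm]
    exact add_mem h h'
  have hsmul : ∀ (c : K) (x : MvPolynomial (Fin n) K),
      (∃ g ∈ polarForms K Finset.univ (m + 1), momentHom t (m + 1) g = 0 ∧
        x - translationDeriv K (Fin n) g ∈ squarefreeForms K Finset.univ (m + 1)) →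
      ∃ g ∈ polarForms K Finset.univ (m + 1), momentHom t (m + 1) g = 0 ∧
        c • x - translationDeriv K (Fin n) g ∈ squarefreeForms K Finset.univ (m + 1) := by
    rintro c x ⟨g, hg, hg0, h⟩
    refine ⟨c • g, Submodule.smul_mem _ c hg, by rw [map_smul, hg0, smul_zero], ?_⟩
    rw [Derivation.map_smul, ← smul_sub]
    exact Submodule.smul_mem _ c h
  have hzero : ∃ g ∈ polarForms K (Finset.univ : Finset (Fin n)) (m + 1),
      momentHom t (m + 1) g = 0 ∧
        0 - translationDeriv K (Fin n) g ∈ squarefreeForms K Finset.univ (m + 1) :=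
    ⟨0, zero_mem _, map_zero _, by simp⟩
  induction hy using Submodule.span_induction with
  | zero => exact hzero
  | add x y _ _ hx hy => exact hadd x y hx hy
  | smul c x _ hx => exact hsmul c x hx
  | mem y hy =>
    obtain ⟨i, -, g, hg, rfl⟩ := hy
    induction hg using Submodule.span_induction with
    | zero => rw [mul_zero]; exact hzero
    | add x y _ _ hx hy => rw [mul_add]; exact hadd _ _ hx hy
    | smul c x _ hx => rw [mul_smul_comm]; exact hsmul _ _ hx
    | mem y hy =>
      obtain ⟨A, hAu, hA, rfl⟩ := hy
      have hB : (Aᶜ).card = m + 1 := by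
        rw [Finset.card_compl, Fintype.card_fin]
        omega
      choose y hy hyX using exists_momentHom_eq_X (K := K) ht hB
      let z : MvPolynomial (Fin n) K := ∑ k : Fin (m + 1), t i ^ (k : ℕ) • y k
      have hz : z ∈ squarefreeForms K Aᶜ 1 :=
        Submodule.sum_mem _ fun k _ => Submodule.smul_mem _ _ (hy k)
      have hzX : momentHom t (m + 1) z = momentHom t (m + 1) (X i) := by
        simp [z, hyX]
      have hzD : translationDeriv K (Fin n) z = 1 := by
        have h1 := translationDeriv_mem_squarefreeForms hz
        rw [squarefreeForms_zero] at h1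
        obtain ⟨c, hc⟩ := Submodule.mem_span_singleton.1 h1
        have h2 : momentHom t (m + 1) (translationDeriv K (Fin n) z) =
            momentHom t (m + 1) (translationDeriv K (Fin n) (X i)) := by
          rw [momentHom_translationDeriv, hzX, ← momentHom_translationDeriv]
        rw [translationDeriv_X, map_one, ← hc, map_smul, map_one, smul_eq_C_mul, mul_one,
          ← C_1] at h2
        rw [← hc, C_injective _ _ h2, one_smul]
      have hxA : ∏ i ∈ A, (X i : MvPolynomial (Fin n) K) ∈ squarefreeForms K Finset.univ m :=
        Submodule.subset_span ⟨A, hAu, hA, rfl⟩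
      obtain ⟨s, hs, hsD⟩ := exists_iterate_translationDeriv_eq (k := 1) hxA
        (by simp; omega)
      change translationDeriv K (Fin n) s = _ at hsD
      refine ⟨(X i - z) * s, ?_, by rw [map_mul, map_sub, hzX, sub_self, zero_mul], ?_⟩
      · rw [sub_mul]
        refine sub_mem (mul_mem_polarForms (Finset.mem_univ i) hs) ?_
        clear hzX hzD
        clear_value z
        induction hz using Submodule.span_induction with
        | mem y hy =>
          obtain ⟨A, hA, hAc, rfl⟩ := hy
          obtain ⟨b, rfl⟩ := Finset.card_eq_one.1 hAc
          rw [Finset.prod_singleton]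
          exact mul_mem_polarForms (Finset.mem_univ b) hs
        | zero => simp
        | add x y _ _ hx hy => rw [add_mul]; exact add_mem hx hy
        | smul c x _ hx => rw [smul_mul_assoc]; exact Submodule.smul_mem _ c hx
      · rw [Derivation.leibniz, map_sub, translationDeriv_X, hzD, sub_self, smul_zero, add_zero,
          hsD, smul_eq_mul, sub_mul, sub_sub_cancel]
        exact mul_prod_X_mem_squarefreeForms disjoint_compl_left hz hA

theorem exists_mem_spechtIdeal_momentHom_eq [CharZero K] (ht : Function.Injective t) {a : ℕ}
    (ha : 1 ≤ a) (hn : n = 2 * a + 1) {h : MvPolynomial (Fin (a + 1)) K}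
    (hh : h.IsHomogeneous (a + 2)) (hh0 : pderiv 0 h = 0) :
    ∃ f ∈ spechtIdeal K n [a, a, 1], f.IsHomogeneous (a + 2) ∧ momentHom t (a + 1) f = h := by
  obtain ⟨f, hf, rfl⟩ := exists_mem_polarForms_momentHom_eq ht (by omega) hh
  obtain ⟨g, hg, hg0, hs⟩ := exists_sub_translationDeriv_mem_squarefreeForms ht hn
    (translationDeriv_mem_polarForms hf)
  have hD : translationDeriv K (Fin n) (f - g) = 0 := by
    rw [map_sub]
    refine eq_zero_of_momentHom_eq_zero ht (by omega) hs ?_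
    rw [map_sub, momentHom_translationDeriv, momentHom_translationDeriv, hg0, hh0, map_zero,
      sub_zero]
  have hfg := sub_mem hf hg
  refine ⟨f - g, ?_, isHomogeneous_of_mem_polarForms hfg, by rw [map_sub, hg0, sub_zero]⟩
  obtain ⟨a, rfl⟩ : ∃ b, a = b + 1 := ⟨a - 1, by omega⟩
  exact tripleForms_le_spechtIdeal n a (by omega)
    (mem_tripleForms_of_mem_polarForms (by simp; omega) hfg hD)

/-- Every form of degree `a + 2` on the image of the moment map without constant term is the
restriction of a form of degree `a + 2` in the Specht ideal of shape `(a, a, 1)`. -/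
theorem exists_mem_spechtIdeal_aeval_eq [CharZero K] (ht : Function.Injective t) {a : ℕ}
    (ha : 1 ≤ a) (hn : n = 2 * a + 1) {h : MvPolynomial (Fin a) K}
    (hh : h.IsHomogeneous (a + 2)) :
    ∃ f ∈ spechtIdeal K n [a, a, 1], f.IsHomogeneous (a + 2) ∧
      aeval (fun i => ∑ k : Fin a, t i ^ (k + 1 : ℕ) • (X k : MvPolynomial (Fin a) K)) f = h := by
  obtain ⟨f, hf, hfh, hfπ⟩ := exists_mem_spechtIdeal_momentHom_eq ht ha hn
    (h := rename Fin.succ h) (hh.rename_isHomogeneous) (by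
      refine pderiv_eq_zero_of_notMem_vars fun h0 => ?_
      obtain ⟨k, -, hk⟩ := Finset.mem_image.1 (vars_rename Fin.succ h h0)
      exact Fin.succ_ne_zero k hk)
  refine ⟨f, hf, hfh, ?_⟩
  let ψ : MvPolynomial (Fin (a + 1)) K →ₐ[K] MvPolynomial (Fin a) K := aeval (Fin.cons 0 X)
  have h1 : ψ (rename Fin.succ h) = h := by
    have : (Fin.cons 0 X : Fin (a + 1) → MvPolynomial (Fin a) K) ∘ Fin.succ = X := by
      ext1 k; simp
    rw [aeval_rename, this, aeval_X_left_apply]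
  rw [← h1, ← hfπ, ← AlgHom.comp_apply]
  congr 1
  ext1 i
  rw [AlgHom.comp_apply, momentHom_X, aeval_X, map_sum, Fin.sum_univ_succ]
  simp [ψ]

end MomentCurve

section LinearSubstitution

variable {K : Type*} [Field K] {ι κ τ : Type*} [Fintype ι] [DecidableEq ι]

/-- The pullback of polynomial functions along a linear map. -/
noncomputable def linSubst (f : (ι → K) →ₗ[K] (κ → K)) :
    MvPolynomial κ K →ₐ[K] MvPolynomial ι K :=
  aeval fun j => ∑ l, f (Pi.single l 1) j • X l

theorem linSubst_X (f : (ι → K) →ₗ[K] (κ → K)) (j : κ) :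
    linSubst f (X j) = ∑ l, f (Pi.single l 1) j • X l :=
  aeval_X _ _

theorem linSubst_linSubst [Fintype κ] [DecidableEq κ] (f : (ι → K) →ₗ[K] (κ → K))
    (g : (κ → K) →ₗ[K] (τ → K)) (p : MvPolynomial τ K) :
    linSubst f (linSubst g p) = linSubst (g ∘ₗ f) p := by
  rw [← AlgHom.comp_apply]
  congr 1
  ext1 j
  rw [AlgHom.comp_apply]
  simp only [linSubst_X, map_sum, map_smul, Finset.smul_sum, smul_smul]
  rw [Finset.sum_comm]
  refine Finset.sum_congr rfl fun l _ => ?_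
  rw [← Finset.sum_smul, LinearMap.comp_apply, pi_eq_sum_univ' (f (Pi.single l 1)), map_sum,
    Finset.sum_apply]
  simp [mul_comm, Pi.single_apply]

theorem linSubst_id (p : MvPolynomial ι K) : linSubst LinearMap.id p = p := by
  rw [← AlgHom.id_apply (R := K) p, ← AlgHom.comp_apply]
  congr 1
  ext1 j
  simp [linSubst_X, Pi.single_apply]

theorem linSubst_add_X (f g : (ι → K) →ₗ[K] (κ → K)) (j : κ) :
    linSubst (f + g) (X j) = linSubst f (X j) + linSubst g (X j) := by
  simp [linSubst_X, add_smul, Finset.sum_add_distrib]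

theorem eval_linSubst_X (f : (ι → K) →ₗ[K] (κ → K)) (x : ι → K) (j : κ) :
    eval x (linSubst f (X j)) = f x j := by
  rw [linSubst_X, pi_eq_sum_univ' x, map_sum, map_sum, Finset.sum_apply]
  simp [smul_eval, mul_comm, Pi.single_apply]

theorem linSubst_injective :
    Function.Injective (linSubst : ((ι → K) →ₗ[K] (κ → K)) → _) := by
  intro f g h
  ext1 l
  ext j
  simp [← eval_linSubst_X, h]

theorem MvPolynomial.IsHomogeneous.linSubst {p : MvPolynomial κ K} {d : ℕ}
    (hp : p.IsHomogeneous d) (f : (ι → K) →ₗ[K] (κ → K)) : (linSubst f p).IsHomogeneous d := by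
  rw [← one_mul d]
  refine hp.aeval _ fun j => IsHomogeneous.sum _ _ _ fun l _ => ?_
  rw [smul_eq_C_mul]
  exact (isHomogeneous_X K l).C_mul _

variable {n a b D : ℕ} {w : (Fin a → K) →ₗ[K] (Fin n → K)} {v : (Fin n → K) →ₗ[K] (Fin a → K)}
  {q : (Fin n → K) →ₗ[K] (Fin b → K)} {s : (Fin b → K) →ₗ[K] (Fin n → K)}

theorem exists_eq_linSubst_add_sum (hvw : v ∘ₗ w = LinearMap.id) (hqw : q ∘ₗ w = 0)
    (hs : w ∘ₗ v + s ∘ₗ q = LinearMap.id) {d : ℕ} {f : MvPolynomial (Fin n) K}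
    (hf : f.IsHomogeneous (d + 1)) : ∃ g : Fin b → MvPolynomial (Fin n) K,
      (∀ j, (g j).IsHomogeneous d) ∧
      f = linSubst v (linSubst w f) + ∑ j, linSubst q (X j) * g j := by
  let Q : ℕ → Submodule K (MvPolynomial (Fin n) K) := fun d => d.casesOn ⊥ fun d =>
    ⨆ j, (homogeneousSubmodule (Fin n) K d).map (LinearMap.mulLeft K (linSubst q (X j)))
  let P : ℕ → Submodule K (MvPolynomial (Fin n) K) := fun d =>
    (homogeneousSubmodule (Fin a) K d).map (linSubst v).toLinearMap ⊔ Q d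
  have hX : ∀ i, (X i : MvPolynomial (Fin n) K) = linSubst v (linSubst w (X i)) +
      linSubst q (linSubst s (X i)) := by
    intro i
    rw [linSubst_linSubst, linSubst_linSubst, ← linSubst_add_X, hs, linSubst_id]
  have hhom : ∀ d, P d ≤ homogeneousSubmodule (Fin n) K d := by
    intro d
    refine sup_le ?_ ?_
    · rintro _ ⟨f, hf, rfl⟩
      exact IsHomogeneous.linSubst hf v
    · obtain _ | d := d
      · exact bot_le
      · refine iSup_le fun j => ?_
        rintro _ ⟨f, hf, rfl⟩
        rw [add_comm]
        exact ((isHomogeneous_X K j).linSubst q).mul hf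
  have hθ : ∀ d, ∀ f : MvPolynomial (Fin n) K, f.IsHomogeneous d → ∀ j,
      linSubst q (X j) * f ∈ P (d + 1) := fun d f hf j =>
    Submodule.mem_sup_right (Submodule.mem_iSup_of_mem j ⟨f, hf, rfl⟩)
  have hu : ∀ d, ∀ f ∈ P d, ∀ k, linSubst v (X k) * f ∈ P (d + 1) := by
    intro d f hf k
    suffices P d ≤ (P (d + 1)).comap (LinearMap.mulLeft K (linSubst v (X k))) from this hf
    refine sup_le ?_ ?_
    · rintro _ ⟨h, hh, rfl⟩
      refine Submodule.mem_sup_left ⟨X k * h, ?_, by simp⟩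
      rw [SetLike.mem_coe, mem_homogeneousSubmodule, add_comm]
      exact (isHomogeneous_X K k).mul hh
    · obtain _ | d := d
      · exact bot_le
      · refine iSup_le fun j => ?_
        rintro _ ⟨g, hg, rfl⟩
        have := hθ (d + 1) (linSubst v (X k) * g) (by
          rw [add_comm]
          exact ((isHomogeneous_X K k).linSubst v).mul hg) j
        rwa [mul_left_comm] at this
  have hfP : f ∈ P (d + 1) := by
    refine hf.mem_of_X_mul_mem ?_ (fun d _ f hf i => ?_) le_rfl
    · exact Submodule.mem_sup_left ⟨1, isHomogeneous_one _ _, map_one (linSubst v)⟩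
    rw [hX, add_mul]
    refine add_mem ?_ ?_
    · rw [linSubst_X, map_sum, Finset.sum_mul]
      refine Submodule.sum_mem _ fun k _ => ?_
      rw [map_smul, smul_mul_assoc]
      exact Submodule.smul_mem _ _ (hu d f hf k)
    · rw [linSubst_X, map_sum, Finset.sum_mul]
      refine Submodule.sum_mem _ fun k _ => ?_
      rw [map_smul, smul_mul_assoc]
      exact Submodule.smul_mem _ _ (hθ d f (hhom d hf) k)
  obtain ⟨_, ⟨h, hh, rfl⟩, y, hy, rfl⟩ := Submodule.mem_sup.1 hfP
  obtain ⟨z, hz, rfl⟩ := (Submodule.mem_iSup_iff_exists_finsupp _ _).1 hy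
  choose g hg hgz using hz
  refine ⟨g, hg, ?_⟩
  have h1 : linSubst w ((linSubst v).toLinearMap h) = h := by
    rw [AlgHom.toLinearMap_apply, linSubst_linSubst, hvw, linSubst_id]
  have h2 : ∀ j, linSubst w (z j) = 0 := by
    intro j
    rw [← hgz, LinearMap.mulLeft_apply, map_mul, linSubst_linSubst, hqw, linSubst_X]
    simp
  rw [map_add, h1, Finsupp.sum_fintype _ _ fun _ => rfl, map_sum,
    Finset.sum_congr rfl fun j _ => h2 j, Finset.sum_const_zero, add_zero]
  simp [← hgz]

/-- If the restrictions to the range of `w` of the elements of degree `D + 1` of an ideal `I` are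
all the forms of degree `D + 1`, then modulo `I` the polynomial ring is spanned, as a module over
the polynomials in the linear forms given by `q`, by the monomials of degree at most `D` in the
linear forms given by `v`. -/
theorem exists_sub_sum_linSubst_mul_mem (hvw : v ∘ₗ w = LinearMap.id) (hqw : q ∘ₗ w = 0)
    (hs : w ∘ₗ v + s ∘ₗ q = LinearMap.id) {I : Ideal (MvPolynomial (Fin n) K)}
    (hI : ∀ h : MvPolynomial (Fin a) K, h.IsHomogeneous (D + 1) →
      ∃ f ∈ I, f.IsHomogeneous (D + 1) ∧ linSubst w f = h) (f : MvPolynomial (Fin n) K) :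
    ∃ c : Sym (Fin (a + 1)) D → MvPolynomial (Fin b) K,
      f - ∑ x, linSubst q (c x) *
        ((x : Multiset (Fin (a + 1))).map (Fin.cons 1 fun k => linSubst v (X k))).prod ∈ I := by
  classical
  let e : Fin (a + 1) → MvPolynomial (Fin n) K := Fin.cons 1 fun k => linSubst v (X k)
  let M : Submodule K (MvPolynomial (Fin n) K) :=
    { carrier := {f | ∃ c : Sym (Fin (a + 1)) D → MvPolynomial (Fin b) K,
        f - ∑ x, linSubst q (c x) * ((x : Multiset (Fin (a + 1))).map e).prod ∈ I}
      zero_mem' := ⟨0, by simp⟩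
      add_mem' := by
        rintro f g ⟨c, hc⟩ ⟨c', hc'⟩
        refine ⟨c + c', ?_⟩
        have := add_mem hc hc'
        simpa only [Pi.add_apply, map_add, add_mul, Finset.sum_add_distrib,
          add_sub_add_comm] using this
      smul_mem' := by
        rintro r f ⟨c, hc⟩
        refine ⟨fun x => C r * c x, ?_⟩
        have := I.mul_mem_left (C r) hc
        have hC : linSubst q (C r) = C r := (linSubst q).commutes r
        simpa only [map_mul, hC, smul_eq_C_mul, mul_sub, Finset.mul_sum, mul_assoc] using this }
  have hMI : ∀ f ∈ I, f ∈ M := fun f hf => ⟨0, by simpa using hf⟩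
  have hMθ : ∀ f ∈ M, ∀ j, linSubst q (X j) * f ∈ M := by
    rintro f ⟨c, hc⟩ j
    refine ⟨fun x => X j * c x, ?_⟩
    have := I.mul_mem_left (linSubst q (X j)) hc
    simpa only [map_mul, mul_sub, Finset.mul_sum, mul_assoc] using this
  have hMe : ∀ x : Sym (Fin (a + 1)) D, ((x : Multiset (Fin (a + 1))).map e).prod ∈ M := by
    intro x
    refine ⟨Pi.single x 1, ?_⟩
    rw [Finset.sum_eq_single x]
    · simp
    · intro y _ hy
      simp [hy]
    · simp
  have hlow : ∀ d ≤ D, ∀ h : MvPolynomial (Fin a) K, h.IsHomogeneous d → linSubst v h ∈ M := by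
    intro d hd h hh
    let N : ℕ → Submodule K (MvPolynomial (Fin a) K) := fun d =>
      (Submodule.span K {f | ∃ m : Multiset (Fin (a + 1)), m.card = d ∧ (m.map e).prod = f}).comap
        (linSubst v).toLinearMap
    have hN : h ∈ N d := by
      refine hh.mem_of_X_mul_mem (D := d) ?_ (fun d _ f hf k => ?_) le_rfl
      · exact Submodule.subset_span ⟨0, by simp⟩
      · rw [Submodule.mem_comap, AlgHom.toLinearMap_apply, map_mul]
        suffices Submodule.span K {f | ∃ m : Multiset (Fin (a + 1)), m.card = d ∧
            (m.map e).prod = f} ≤ (Submodule.span K {f | ∃ m : Multiset (Fin (a + 1)),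
            m.card = d + 1 ∧ (m.map e).prod = f}).comap (LinearMap.mulLeft K (linSubst v (X k)))
          from this hf
        rw [Submodule.span_le]
        rintro _ ⟨m, hm, rfl⟩
        exact Submodule.subset_span ⟨k.succ ::ₘ m, by simp [hm], by simp [e]⟩
    refine Submodule.span_le.2 ?_ hN
    rintro _ ⟨m, hm, rfl⟩
    have := hMe ⟨Multiset.replicate (D - d) 0 + m, by simp [hm]; omega⟩
    simpa [e] using this
  have hhigh : ∀ d, ∀ h : MvPolynomial (Fin a) K, h.IsHomogeneous (D + 1 + d) →
      ∃ f ∈ I, f.IsHomogeneous (D + 1 + d) ∧ linSubst w f = h := by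
    intro d h hh
    let P : ℕ → Submodule K (MvPolynomial (Fin a) K) := fun d =>
      if d < D + 1 then homogeneousSubmodule (Fin a) K d else
        (I.restrictScalars K ⊓ homogeneousSubmodule (Fin n) K d).map (linSubst w).toLinearMap
    have hP : h ∈ P (D + 1 + d) := by
      refine hh.mem_of_X_mul_mem (D := D + 1 + d) ?_ (fun d _ f hf k => ?_) le_rfl
      · simp only [P, Nat.zero_lt_succ, if_true]
        exact isHomogeneous_one _ _
      · by_cases hd : d < D + 1
        · simp only [P, hd, if_true] at hf
          have hXf : (X k * f).IsHomogeneous (d + 1) := by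
            rw [add_comm]
            exact (isHomogeneous_X K k).mul hf
          by_cases hd' : d + 1 < D + 1
          · simpa only [P, hd', if_true] using (mem_homogeneousSubmodule _ _).2 hXf
          · obtain rfl : d = D := by omega
            simp only [P, hd', if_false]
            obtain ⟨F, hF, hF', hFf⟩ := hI _ hXf
            exact ⟨F, ⟨hF, hF'⟩, hFf⟩
        · simp only [P, hd, if_false] at hf
          simp only [P, show ¬ d + 1 < D + 1 by omega, if_false]
          obtain ⟨F, ⟨hF, hF'⟩, rfl⟩ := hf
          refine ⟨linSubst v (X k) * F, ⟨I.mul_mem_left _ hF, ?_⟩, ?_⟩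
          · rw [SetLike.mem_coe, mem_homogeneousSubmodule, add_comm]
            exact ((isHomogeneous_X K k).linSubst v).mul hF'
          · rw [AlgHom.toLinearMap_apply, map_mul, linSubst_linSubst, hvw, linSubst_id]
            rfl
    simp only [P, show ¬ D + 1 + d < D + 1 by omega, if_false] at hP
    obtain ⟨F, ⟨hF, hF'⟩, rfl⟩ := hP
    exact ⟨F, hF, hF', rfl⟩
  have hM : ∀ d, ∀ f : MvPolynomial (Fin n) K, f.IsHomogeneous d → f ∈ M := by
    intro d
    induction d with
    | zero =>
      intro f hf
      obtain ⟨c, rfl⟩ : ∃ c, f = C c :=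
        ⟨_, totalDegree_eq_zero_iff_eq_C.1 ((totalDegree_zero_iff_isHomogeneous (Fin n)).2 hf)⟩
      have := hlow 0 (Nat.zero_le _) (C c) (isHomogeneous_C _ _)
      rwa [← algebraMap_eq, AlgHom.commutes, algebraMap_eq] at this
    | succ d ih =>
      intro f hf
      by_cases hd : d + 1 ≤ D
      · obtain ⟨g, hg, h⟩ := exists_eq_linSubst_add_sum hvw hqw hs hf
        rw [h]
        exact add_mem (hlow _ hd _ (hf.linSubst w))
          (Submodule.sum_mem _ fun j _ => hMθ _ (ih _ (hg j)) j)
      · obtain ⟨d', hd'⟩ : ∃ d', d + 1 = D + 1 + d' := ⟨d - D, by omega⟩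
        obtain ⟨F, hF, hF', h⟩ := hhigh d' (linSubst w f) (hd' ▸ hf.linSubst w)
        obtain ⟨g, hg, h'⟩ := exists_eq_linSubst_add_sum hvw hqw hs (hf.sub (hd' ▸ hF'))
        rw [map_sub, h, sub_self, map_zero, zero_add] at h'
        rw [← sub_add_cancel f F, h']
        exact add_mem (Submodule.sum_mem _ fun j _ => hMθ _ (ih _ (hg j)) j) (hMI _ hF)
  have : f ∈ M := by
    rw [← sum_homogeneousComponent f]
    exact Submodule.sum_mem _ fun d _ => hM d _ (homogeneousComponent_isHomogeneous d f)
  exact this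

end LinearSubstitution

/-- A quotient ring `R ⧸ I` is Cohen–Macaulay if it is spanned over the image of a regular domain
by at most as many elements as there are retractions onto that domain. -/
theorem IsCohenMacaulayRing.quotient_of_retractions {S R ι κ : Type*} [CommRing S] [IsDomain S]
    [IsRegularRing S] [CommRing R] [Fintype ι] [Fintype κ] (φ : S →+* R) (I : Ideal R)
    (ρ : ι → R →+* S) (hφ : ∀ i, (ρ i).comp φ = RingHom.id S) (hI : ∀ i, I ≤ RingHom.ker (ρ i))
    (hρ : Function.Injective ρ) (v : κ → R) (hv : ∀ f, ∃ c : κ → S, f - ∑ k, φ (c k) * v k ∈ I)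
    (hcard : Fintype.card κ ≤ Fintype.card ι) : IsCohenMacaulayRing (R ⧸ I) := by
  let _ : Algebra S (R ⧸ I) := ((Ideal.Quotient.mk I).comp φ).toAlgebra
  have halg : ∀ c, algebraMap S (R ⧸ I) c = Ideal.Quotient.mk I (φ c) := fun _ => rfl
  let ρ' : ι → (R ⧸ I) →ₐ[S] S := fun i =>
    { Ideal.Quotient.lift I (ρ i) (hI i) with
      commutes' := fun c => DFunLike.congr_fun (hφ i) c }
  have hρ' : ∀ i f, ρ' i (Ideal.Quotient.mk I f) = ρ i f := fun _ _ => rfl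
  obtain ⟨_, _⟩ := Module.free_and_finite_of_card_le_card_algHom ρ' (fun i j h => hρ <| by
      ext f
      rw [← hρ', ← hρ', h]) (fun k => Ideal.Quotient.mk I (v k)) (fun f _ => by
      obtain ⟨f, rfl⟩ := Ideal.Quotient.mk_surjective f
      obtain ⟨c, hc⟩ := hv f
      rw [Ideal.Quotient.eq.2 hc, map_sum]
      refine Submodule.sum_mem _ fun k _ => ?_
      rw [map_mul, ← halg, ← Algebra.smul_def]
      exact Submodule.smul_mem _ _ (Submodule.subset_span ⟨k, rfl⟩)) hcard
  exact IsCohenMacaulayRing.of_finite_of_flat S _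

section Retractions

variable {K : Type*} [Field K] {n : ℕ}

/-- The linear map sending `c` to the values at `t` of the polynomial without constant term with
coefficients `c`. -/
noncomputable def momentMap (t : Fin n → K) (a : ℕ) : (Fin a → K) →ₗ[K] (Fin n → K) :=
  LinearMap.pi fun i => ∑ k : Fin a, t i ^ (k + 1 : ℕ) • LinearMap.proj k

theorem momentMap_apply (t : Fin n → K) {a : ℕ} (c : Fin a → K) (i : Fin n) :
    momentMap t a c i = ∑ k : Fin a, t i ^ (k + 1 : ℕ) * c k := by
  simp [momentMap]

theorem linSubst_momentMap (t : Fin n → K) (a : ℕ) :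
    linSubst (momentMap t a) = aeval fun i => ∑ k : Fin a, t i ^ (k + 1 : ℕ) • X k := by
  ext1 i
  simp [linSubst_X, momentMap_apply, Pi.single_apply]

/-- A polynomial of degree at most `a` without constant term taking the same value at more than `a`
points is zero. -/
theorem eq_zero_of_momentMap_eq {t : Fin n → K} (ht : Function.Injective t) {a : ℕ}
    {c : Fin a → K} {H : Finset (Fin n)} (hH : a < H.card) {r : K}
    (hr : ∀ i ∈ H, momentMap t a c i = r) : c = 0 := by
  classical
  let p : Polynomial K := ∑ k : Fin a, Polynomial.C (c k) * Polynomial.X ^ (k + 1 : ℕ)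
  have hdeg : p.natDegree ≤ a := Polynomial.natDegree_sum_le_of_forall_le _ _ fun k _ =>
    (Polynomial.natDegree_C_mul_X_pow_le _ _).trans k.2
  have hp : p - Polynomial.C r = 0 := by
    refine Polynomial.eq_zero_of_natDegree_lt_card_of_eval_eq_zero' _ (H.image t) ?_ ?_
    · intro x hx
      obtain ⟨i, hi, rfl⟩ := Finset.mem_image.1 hx
      rw [Polynomial.eval_sub, Polynomial.eval_C, sub_eq_zero, ← hr i hi, momentMap_apply,
        Polynomial.eval_finsetSum]
      refine Finset.sum_congr rfl fun k _ => ?_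
      rw [Polynomial.eval_mul, Polynomial.eval_C, Polynomial.eval_pow, Polynomial.eval_X, mul_comm]
    · rw [Finset.card_image_of_injective _ ht]
      refine lt_of_le_of_lt ((Polynomial.natDegree_sub_le _ _).trans ?_) hH
      simpa using hdeg
  ext k
  have := congrArg (fun p => Polynomial.coeff p (k + 1)) hp
  simpa [p, Polynomial.coeff_C, Polynomial.coeff_X_pow, Fin.val_inj, Finset.sum_ite_eq]
    using this

/-- An injective linear map is part of a split short exact sequence. -/
theorem exists_splitting_of_injective {a b : ℕ} (hab : a + b = n)
    {w : (Fin a → K) →ₗ[K] (Fin n → K)} (hw : Function.Injective w) :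
    ∃ (v : (Fin n → K) →ₗ[K] (Fin a → K)) (q : (Fin n → K) →ₗ[K] (Fin b → K))
      (s : (Fin b → K) →ₗ[K] (Fin n → K)), v ∘ₗ w = LinearMap.id ∧ q ∘ₗ w = 0 ∧
      w ∘ₗ v + s ∘ₗ q = LinearMap.id := by
  obtain ⟨v, hv⟩ := w.exists_leftInverse_of_injective (LinearMap.ker_eq_bot.2 hw)
  have hrank : Module.finrank K ((Fin n → K) ⧸ LinearMap.range w) =
      Module.finrank K (Fin b → K) := by
    have := Submodule.finrank_quotient_add_finrank (LinearMap.range w)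
    rw [LinearMap.finrank_range_of_inj hw] at this
    simp only [Module.finrank_fin_fun] at this ⊢
    omega
  let e := LinearEquiv.ofFinrankEq _ _ hrank
  have hproj : LinearMap.range w ≤ LinearMap.ker (LinearMap.id - w ∘ₗ v) := by
    rintro _ ⟨c, rfl⟩
    have := LinearMap.congr_fun hv c
    simp only [LinearMap.comp_apply, LinearMap.id_apply] at this
    simp [this]
  refine ⟨v, e.toLinearMap ∘ₗ (LinearMap.range w).mkQ,
    (LinearMap.range w).liftQ _ hproj ∘ₗ e.symm.toLinearMap, hv, ?_, ?_⟩
  · refine LinearMap.ext fun c => ?_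
    have : (LinearMap.range w).mkQ (w c) = 0 :=
      (Submodule.Quotient.mk_eq_zero _).2 (LinearMap.mem_range_self w c)
    simp only [LinearMap.comp_apply, this, map_zero, LinearMap.zero_apply]
  · ext1 k
    ext j
    simp

/-- If no nonzero vector of the kernel of `q` is constant on `H`, then `q` has a section with
values constant on `H`. -/
theorem exists_section_constant_on {b : ℕ} {q : (Fin n → K) →ₗ[K] (Fin b → K)}
    {H : Finset (Fin n)} (hcard : n + 1 = b + H.card) (hH : H.Nonempty)
    (hq : ∀ x, q x = 0 → (∀ i ∈ H, ∀ j ∈ H, x i = x j) → x = 0) :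
    ∃ r : (Fin b → K) →ₗ[K] (Fin n → K), q ∘ₗ r = LinearMap.id ∧
      (∀ y, ∀ i ∈ H, ∀ j ∈ H, r y i = r y j) ∧
      ∀ x, (∀ i ∈ H, ∀ j ∈ H, x i = x j) → ∃ y, r y = x := by
  classical
  obtain ⟨h, hh⟩ := hH
  let J : Finset (Fin n) := insert h Hᶜ
  have hJ : J.card = b := by
    rw [Finset.card_insert_of_notMem (by simpa using hh), Finset.card_compl, Fintype.card_fin]
    have := H.card_le_univ
    rw [Fintype.card_fin] at this
    omega
  have hmem : ∀ i, (if i ∈ H then h else i) ∈ J := by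
    intro i
    split_ifs with hi <;> simp [J, hi]
  let c : (J → K) →ₗ[K] (Fin n → K) := LinearMap.funLeft K K fun i => ⟨_, hmem i⟩
  have hc : ∀ x i, c x i = x ⟨_, hmem i⟩ := fun _ _ => rfl
  have hcH : ∀ x, ∀ i ∈ H, ∀ j ∈ H, c x i = c x j := by
    intro x i hi j hj
    simp [hc, hi, hj]
  have hcsurj : ∀ x, (∀ i ∈ H, ∀ j ∈ H, x i = x j) → ∃ y, c y = x := by
    intro x hx
    refine ⟨fun j => x j, ?_⟩
    ext i
    by_cases hi : i ∈ H
    · simpa [hc, hi] using hx h hh i hi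
    · simp [hc, hi]
  have hinj : Function.Injective (q ∘ₗ c) := by
    rw [← LinearMap.ker_eq_bot, LinearMap.ker_eq_bot']
    intro x hx
    have h0 := hq (c x) hx (hcH x)
    ext ⟨j, hj⟩
    have := congrFun h0 j
    rw [hc, Pi.zero_apply] at this
    rw [Pi.zero_apply, ← this]
    congr 2
    rcases Finset.mem_insert.1 hj with rfl | hj
    · simp
    · simp [Finset.mem_compl.1 hj]
  let e := LinearEquiv.ofInjectiveOfFinrankEq (q ∘ₗ c) hinj (by simp [hJ])
  have he : ∀ x, e x = q (c x) := fun _ => rfl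
  refine ⟨c ∘ₗ e.symm.toLinearMap, ?_, fun y => hcH _, fun x hx => ?_⟩
  · refine LinearMap.ext fun y => ?_
    exact (he _).symm.trans (e.apply_symm_apply y)
  · obtain ⟨y, hy⟩ := hcsurj x hx
    exact ⟨e y, by simp [hy]⟩

/-- A linear substitution identifying more than `a` variables kills the Specht polynomials of
shapes with `a` columns. -/
theorem spechtIdeal_le_ker_linSubst {a : ℕ} (ha : 1 ≤ a) {ι : Type*} [Fintype ι] [DecidableEq ι]
    {r : (ι → K) →ₗ[K] (Fin n → K)} {H : Finset (Fin n)} (hH : a < H.card)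
    (hr : ∀ y, ∀ i ∈ H, ∀ j ∈ H, r y i = r y j) :
    spechtIdeal K n [a, a, 1] ≤ RingHom.ker (linSubst r) := by
  refine Ideal.span_le.2 ?_
  rintro _ ⟨T, hT, rfl⟩
  have hcol : ∀ i ∈ H, (T i).2 ∈ Finset.range a := by
    intro i _
    obtain ⟨h1, h2⟩ := hT.2.1 i
    rw [Finset.mem_range]
    generalize (T i).1 = k at h1 h2
    simp only [List.length_cons, List.length_nil] at h1
    interval_cases k <;> simp at h2 <;> omega
  obtain ⟨i, hi, j, hj, hij, h⟩ := Finset.exists_ne_map_eq_of_card_lt_of_maps_to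
    (by simpa using hH) hcol
  have key : ∀ i ∈ H, ∀ j ∈ H, (T i).2 = (T j).2 → (T i).1 < (T j).1 →
      linSubst r (spechtPoly K T) = 0 := by
    intro i hi j hj h h'
    rw [spechtPoly, map_prod]
    refine Finset.prod_eq_zero (i := (i, j)) (by simp [h, h']) ?_
    rw [map_sub, linSubst_X, linSubst_X, sub_eq_zero]
    exact Finset.sum_congr rfl fun l _ => by rw [hr _ i hi j hj]
  rcases lt_trichotomy (T i).1 (T j).1 with h' | h' | h'
  · exact key i hi j hj h h'
  · exact absurd (hT.1 (Prod.ext h' h)) hij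
  · exact key j hj i hi h.symm h'

end Retractions

/-- Corollary 4.6: if `char K = 0` and `n = 2a + 1`, then `R/I^Sp_{(a, a, 1)}` is
Cohen–Macaulay. -/
theorem specht_aa1_CM {K : Type*} [Field K] [CharZero K] (n a : ℕ)
    (ha : 1 ≤ a) (hn : n = 2 * a + 1) :
    IsCohenMacaulayRing (MvPolynomial (Fin n) K ⧸ spechtIdeal K n [a, a, 1]) := by
  let t : Fin n → K := fun i => (i : ℕ)
  have ht : Function.Injective t := fun i j h => Fin.ext (Nat.cast_injective h)
  have hw : Function.Injective (momentMap t a) := by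
    rw [← LinearMap.ker_eq_bot, LinearMap.ker_eq_bot']
    intro c hc
    exact eq_zero_of_momentMap_eq ht (H := Finset.univ) (by simp; omega) fun i _ => congrFun hc i
  obtain ⟨v, q, s, hvw, hqw, hs⟩ := exists_splitting_of_injective (b := a + 1) (by omega) hw
  have hq : ∀ H : {H : Finset (Fin n) // H.card = a + 1}, ∀ x, q x = 0 →
      (∀ i ∈ H.1, ∀ j ∈ H.1, x i = x j) → x = 0 := by
    intro H x hx hH
    obtain ⟨h, hh⟩ : H.1.Nonempty := Finset.card_pos.1 (by rw [H.2]; omega)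
    have hwx : momentMap t a (v x) = x := by
      simpa [hx] using LinearMap.congr_fun hs x
    have hv : v x = 0 := eq_zero_of_momentMap_eq ht (H := H.1) (by rw [H.2]; omega) (r := x h)
      fun i hi => by rw [hwx, hH i hi h hh]
    rw [← hwx, hv, map_zero]
  choose r hqr hconst hr using fun H : {H : Finset (Fin n) // H.card = a + 1} =>
    exists_section_constant_on (by rw [H.2]; omega)
      (Finset.card_pos.1 (by rw [H.2]; omega)) (hq H)
  refine IsCohenMacaulayRing.quotient_of_retractions (linSubst q).toRingHom _
    (fun H => (linSubst (r H)).toRingHom) (fun H => ?_) (fun H => ?_) ?_ _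
    (exists_sub_sum_linSubst_mul_mem hvw hqw hs (D := a + 1) fun h hh => ?_) ?_
  · refine RingHom.ext fun f => ?_
    exact (linSubst_linSubst _ _ _).trans (by rw [hqr, linSubst_id]; rfl)
  · exact spechtIdeal_le_ker_linSubst ha (by rw [H.2]; omega) (hconst H)
  · intro H H' h
    have hrr : r H = r H' := linSubst_injective (AlgHom.ext fun f => RingHom.congr_fun h f)
    refine Subtype.ext (Finset.eq_of_subset_of_card_le (fun j hj => ?_) (by rw [H.2, H'.2]))
    by_contra hj'
    obtain ⟨y, hy⟩ := hr H' (Pi.single j 1) fun i hi i' hi' => by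
      rw [Pi.single_eq_of_ne (ne_of_mem_of_not_mem hi hj'),
        Pi.single_eq_of_ne (ne_of_mem_of_not_mem hi' hj')]
    obtain ⟨i, hi, hij⟩ := Finset.exists_mem_ne (by rw [H.2]; omega) j
    have := hconst H y i hi j hj
    rw [hrr, hy, Pi.single_eq_same, Pi.single_eq_of_ne hij] at this
    exact zero_ne_one this
  · rw [linSubst_momentMap]
    exact exists_mem_spechtIdeal_aeval_eq ht ha hn hh
  · rw [Sym.card_sym_fin_eq_multichoose, Nat.multichoose_eq, Fintype.card_finset_len,
      Fintype.card_fin, hn]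
    exact le_of_eq (by congr 1; omega)
end

section
/- For any field K and any n ≥ 4, the ring R/I^Sp_{(n−2,2)} is Cohen–Macaulay, and its Hilbert series is (1 + (n−2)t + t²)/(1−t)²; equivalently, the dimension over K of the degree-m homogeneous component of R/I^Sp_{(n−2,2)} equals 1 for m = 0 and n·m for all m ≥ 1. -/
open MvPolynomial

open RingTheory.Sequence in
/-- In a factorial Noetherian domain of dimension at most two, every prime is minimal over an ideal
generated by a regular sequence. -/
theorem exists_isWeaklyRegular_mem_minimalPrimes {S : Type*} [CommRing S] [IsDomain S]
    [UniqueFactorizationMonoid S] (hdim : ringKrullDim S ≤ 2) (p : Ideal S) [hp : p.IsPrime] :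
    ∃ rs : List S, IsWeaklyRegular S rs ∧ p ∈ (Ideal.ofList rs).minimalPrimes := by
  by_cases h0 : p = ⊥
  · subst h0
    exact ⟨[], IsWeaklyRegular.nil _ _, ⟨hp, by simp⟩, fun _ _ _ ↦ bot_le⟩
  obtain ⟨f, hfp, hf⟩ := hp.exists_mem_prime_of_ne_bot h0
  have hfprime : (Ideal.span {f}).IsPrime := (Ideal.span_singleton_prime hf.ne_zero).2 hf
  have hle : Ideal.span {f} ≤ p := (Ideal.span_singleton_le_iff_mem _).2 hfp
  have hfreg : IsSMulRegular S f := IsSMulRegular.of_ne_zero hf.ne_zero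
  by_cases hpf : p = Ideal.span {f}
  · refine ⟨[f], (isWeaklyRegular_singleton_iff _ _).2 hfreg, ?_⟩
    rw [Ideal.ofList_singleton, ← hpf, Ideal.minimalPrimes_eq_subsingleton_self]
    rfl
  obtain ⟨g, hgp, hgf⟩ := SetLike.exists_of_lt (lt_of_le_of_ne hle (Ne.symm hpf))
  refine ⟨[f, g], .cons hfreg ((isWeaklyRegular_singleton_iff _ _).2 ?_), ?_⟩
  · refine (isSMulRegular_quotient_iff_mem_of_smul_mem _ _).2 fun x hx ↦ ?_
    rw [← Submodule.ideal_span_singleton_smul, smul_eq_mul, Ideal.mul_top] at hx ⊢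
    exact (hfprime.mem_or_mem hx).resolve_left hgf
  · have hmem {q : Ideal S} : Ideal.ofList [f, g] ≤ q ↔ f ∈ q ∧ g ∈ q := by
      simp [Ideal.ofList_cons]
    refine ⟨⟨hp, hmem.2 ⟨hfp, hgp⟩⟩, fun q ⟨hq, hfgq⟩ hqp ↦ ?_⟩
    obtain ⟨hfq, hgq⟩ := hmem.1 hfgq
    by_contra hpq
    have h₁ : (⊥ : Ideal S) < Ideal.span {f} :=
      bot_lt_iff_ne_bot.2 (by simpa using hf.ne_zero)
    have h₂ : Ideal.span {f} < q :=
      lt_of_le_of_ne ((Ideal.span_singleton_le_iff_mem _).2 hfq) (fun h ↦ hgf (h ▸ hgq))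
    have h₃ : q < p := lt_of_le_not_ge hqp hpq
    let s : LTSeries (PrimeSpectrum S) :=
      { length := 3
        toFun := ![⟨⊥, Ideal.isPrime_bot⟩, ⟨_, hfprime⟩, ⟨q, hq⟩, ⟨p, hp⟩]
        step := by
          intro i
          fin_cases i
          · exact h₁
          · exact h₂
          · exact h₃ }
    have := (Order.LTSeries.length_le_krullDim s).trans hdim
    norm_cast at this

open RingTheory.Sequence in
/-- A Noetherian ring that is flat and integral over a factorial Noetherian domain of dimension
at most two is Cohen–Macaulay. -/
theorem isCohenMacaulayRing_of_flat_of_isIntegral {S A : Type*} [CommRing S] [IsDomain S]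
    [UniqueFactorizationMonoid S] (hdim : ringKrullDim S ≤ 2)
    [CommRing A] [IsNoetherianRing A] [Algebra S A] [Module.Flat S A] [Algebra.IsIntegral S A] :
    IsCohenMacaulayRing A := by
  intro P hP
  obtain ⟨rs, hrs, hmin⟩ := exists_isWeaklyRegular_mem_minimalPrimes hdim (P.comap (algebraMap S A))
  let L := Localization.AtPrime P
  have hmem : ∀ r ∈ rs.map (algebraMap S A), r ∈ P := by
    intro r hr
    obtain ⟨s, hs, rfl⟩ := List.mem_map.1 hr
    exact hmin.1.2 (Ideal.subset_span hs)
  have hreg : IsRegular L ((rs.map (algebraMap S A)).map (algebraMap A L)) :=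
    (hrs.of_flat (S := A)).isRegular_of_isLocalization_of_mem L P hmem
  set ts := (rs.map (algebraMap S A)).map (algebraMap A L) with hts
  have hJ : ∀ J ∈ (Ideal.ofList ts).minimalPrimes, J.IsMaximal := by
    intro J hJ
    have hJp : J.IsPrime := hJ.1.1
    have hJP : J.comap (algebraMap A L) ≤ P := by
      have := Ideal.comap_mono (f := algebraMap A L) (IsLocalRing.le_maximalIdeal hJp.ne_top)
      exact this.trans_eq (Localization.AtPrime.under_maximalIdeal (I := P))
    have hle : P.comap (algebraMap S A) ≤ (J.comap (algebraMap A L)).comap (algebraMap S A) := by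
      refine hmin.2 ⟨inferInstance, ?_⟩ (Ideal.comap_mono hJP)
      refine Ideal.span_le.2 fun s hs ↦ hJ.1.2 (Ideal.subset_span ?_)
      exact List.mem_map_of_mem (List.mem_map_of_mem hs)
    have heq : J.comap (algebraMap A L) = P := by
      by_contra hne
      exact (Ideal.IsIntegral.comap_lt_comap (R := S) (lt_of_le_of_ne hJP hne)).not_ge hle
    have : IsLocalRing.maximalIdeal L ≤ J := by
      rw [← Localization.AtPrime.map_eq_maximalIdeal, Ideal.map_le_iff_le_comap]
      exact heq.ge
    rw [← (IsLocalRing.maximalIdeal.isMaximal L).eq_of_le hJp.ne_top this]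
    infer_instance
  have hzero : ringKrullDim (L ⧸ Ideal.ofList ts) = 0 := by
    have : Nontrivial (L ⧸ Ideal.ofList ts) := by
      refine Ideal.Quotient.nontrivial_iff.2 fun h ↦ hreg.2 ?_
      rw [h, Submodule.top_smul]
    exact ringKrullDimZero_iff_ringKrullDim_eq_zero.1
      (Ideal.krullDimLE_zero_quotient_iff_forall_minimalPrimes_isMaximal.2 hJ)
  have hdimL := ringKrullDim_add_length_eq_ringKrullDim_of_isRegular ts hreg
  rw [hzero, zero_add] at hdimL
  refine le_antisymm ?_ ?_
  · have hfin : (ringDepth L : WithBot ℕ∞) ≤ ringKrullDim L := by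
      rw [← hdimL]
      refine WithBot.coe_le_coe.2 (iSup_le fun us ↦ ?_)
      have hu := ringKrullDim_add_length_eq_ringKrullDim_of_isRegular us.1 us.2.2
      have : Nontrivial (L ⧸ Ideal.ofList us.1) := by
        refine Ideal.Quotient.nontrivial_iff.2 fun h ↦ us.2.2.2 ?_
        rw [h, Submodule.top_smul]
      have h0 := ringKrullDim_nonneg_of_nontrivial (R := L ⧸ Ideal.ofList us.1)
      have : ((us.1.length : ℕ∞) : WithBot ℕ∞) ≤ ((ts.length : ℕ∞) : WithBot ℕ∞) := by
        calc ((us.1.length : ℕ∞) : WithBot ℕ∞) = 0 + (us.1.length : WithBot ℕ∞) := by simp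
          _ ≤ _ := add_le_add_left h0 _
          _ = _ := by rw [hu, ← hdimL]; rfl
      exact WithBot.coe_le_coe.1 this
    exact hfin
  · rw [← hdimL]
    refine WithBot.coe_le_coe.2 (le_iSup_of_le ⟨ts, ?_, hreg⟩ le_rfl)
    intro r hr
    obtain ⟨a, ha, rfl⟩ := List.mem_map.1 hr
    rw [IsLocalRing.jacobson_eq_maximalIdeal _ bot_ne_top,
      IsLocalization.AtPrime.to_map_mem_maximal_iff L P]
    exact hmem a ha

section PolynomialMap

attribute [local instance] Polynomial.algebra

theorem flat_mapRingHom {S B : Type*} [CommRing S] [CommRing B] {f : S →+* B} (hf : f.Flat) :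
    RingHom.Flat (R := Polynomial S) (S := Polynomial B) (Polynomial.mapRingHom f) := by
  algebraize [f]
  exact Module.Flat.isBaseChange _ _ _ _ (Algebra.IsPushout.out (R := S) (S := Polynomial S) (R' := B))

theorem isIntegral_mapRingHom {S B : Type*} [CommRing S] [CommRing B] {f : S →+* B}
    (hf : f.IsIntegral) :
    RingHom.IsIntegral (R := Polynomial S) (A := Polynomial B) (Polynomial.mapRingHom f) := by
  algebraize [f]
  exact Algebra.IsIntegral.isIntegral (R := Polynomial S) (A := Polynomial B)

end PolynomialMap

noncomputable section

/-- The vanishing ideal of the coordinate axes together with the line spanned by `(1, …, 1)`. -/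
def axesIdeal (K : Type*) [CommRing K] (N : ℕ) : Ideal (MvPolynomial (Fin N) K) :=
  Ideal.span {f | ∃ i k l, i ≠ k ∧ i ≠ l ∧ f = X i * (X k - X l)}

/-- The coordinate ring of the coordinate axes together with the line spanned by `(1, …, 1)`. -/
abbrev AxesRing (K : Type*) [CommRing K] (N : ℕ) : Type _ := MvPolynomial (Fin N) K ⧸ axesIdeal K N

namespace AxesRing

section CommRing

variable {K : Type*} [CommRing K]

variable (K) in
/-- The coordinate functions. -/
def y {N : ℕ} (i : Fin N) : AxesRing K N := Ideal.Quotient.mk _ (X i)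

/-- Restriction to the line indexed by `j`: the `i`-th axis for `some i`, and the diagonal line for
`none`. -/
def toLine (K : Type*) [CommRing K] {N : ℕ} (j : Option (Fin N)) :
    AxesRing K N →ₐ[K] Polynomial K :=
  Ideal.Quotient.liftₐ _ (aeval fun i ↦ if j = none ∨ j = some i then Polynomial.X else 0) <| by
    intro a ha
    rw [← RingHom.mem_ker]
    revert a
    refine Ideal.span_le.2 ?_
    rintro _ ⟨i, k, l, hik, hil, rfl⟩
    simp only [SetLike.mem_coe, RingHom.mem_ker, map_mul, map_sub, aeval_X]
    cases j <;> grind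

@[simp] theorem toLine_none_y {N : ℕ} (i : Fin N) : toLine K none (y K i) = Polynomial.X :=
  (Ideal.Quotient.lift_mk ..).trans (by simp)

@[simp] theorem toLine_some_y {N : ℕ} (i j : Fin N) :
    toLine K (some j) (y K i) = if j = i then Polynomial.X else 0 :=
  (Ideal.Quotient.lift_mk ..).trans (by simp)

theorem y_mul_y_eq {N : ℕ} {i k l : Fin N} (hk : i ≠ k) (hl : i ≠ l) :
    y K i * y K k = y K i * y K l := by
  rw [← sub_eq_zero, ← mul_sub]
  exact Ideal.Quotient.eq_zero_iff_mem.2 (Ideal.subset_span ⟨i, k, l, hk, hl, rfl⟩)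

variable {M : ℕ}

theorem y_mul_y {i k : Fin (M + 3)} (h : i ≠ k) : y K i * y K k = y K 0 * y K 1 := by
  have h01 : (0 : Fin (M + 3)) ≠ 1 := by simp
  by_cases hi : i = 0
  · subst hi
    exact y_mul_y_eq h h01
  · rw [y_mul_y_eq h hi, mul_comm]
    exact y_mul_y_eq (Ne.symm hi) h01

theorem y_mul_y_mul_y (i : Fin (M + 3)) :
    y K i * (y K 0 * y K 1) = y K 0 * y K 1 * y K 1 := by
  by_cases hi : i = 0
  · subst hi
    have h12 : (1 : Fin (M + 3)) ≠ 2 := by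
      rw [Ne, Fin.ext_iff, Fin.val_one, Fin.val_two]; lia
    have h02 : (0 : Fin (M + 3)) ≠ 2 := by
      rw [Ne, Fin.ext_iff, Fin.val_zero, Fin.val_two]; lia
    linear_combination (-y K 0) * y_mul_y (K := K) h12 + y K 1 * y_mul_y (K := K) h02
  · rw [← mul_assoc, y_mul_y hi]

/-- A `K`-basis of `AxesRing K (M + 3)` by images of monomials. -/
def e (K : Type*) [CommRing K] {M : ℕ} : ℕ × Option (Fin (M + 3)) → AxesRing K (M + 3)
  | (d, some i) => y K i ^ (d + 1)
  | (0, none) => 1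
  | (d + 1, none) => y K 0 * y K 1 ^ (d + 1)

/-- The degree of the basis elements `e`. -/
def deg {M : ℕ} : ℕ × Option (Fin (M + 3)) → ℕ
  | (d, some _) => d + 1
  | (0, none) => 0
  | (d + 1, none) => d + 2

theorem eq_of_deg_le_zero {α : ℕ × Option (Fin (M + 3))} (h : deg α ≤ 0) : α = (0, none) := by
  obtain ⟨_ | _, _ | _⟩ := α <;> simp_all [deg]

theorem y_mul_e_none (i : Fin (M + 3)) (d : ℕ) :
    y K i * (y K 0 * y K 1 ^ (d + 1)) = y K 0 * y K 1 ^ (d + 2) := by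
  linear_combination (y K 1 ^ d) * y_mul_y_mul_y (K := K) i

theorem y_mul_y_pow {i j : Fin (M + 3)} (h : i ≠ j) (d : ℕ) :
    y K i * y K j ^ (d + 1) = y K 0 * y K 1 ^ (d + 1) := by
  induction d with
  | zero => simpa using y_mul_y h
  | succ d ih => rw [pow_succ' _ (d + 1), mul_left_comm, ih, y_mul_e_none]

theorem exists_y_mul_e (i : Fin (M + 3)) (α : ℕ × Option (Fin (M + 3))) :
    ∃ β, y K i * e K α = e K β ∧ deg β = deg α + 1 := by
  match α with
  | (0, none) => exact ⟨(0, some i), by simp [e], rfl⟩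
  | (d + 1, none) => exact ⟨(d + 2, none), y_mul_e_none i d, rfl⟩
  | (d, some j) =>
    by_cases h : i = j
    · subst h
      exact ⟨(d + 1, some i), (pow_succ' _ _).symm, rfl⟩
    · exact ⟨(d + 1, none), y_mul_y_pow h d, rfl⟩

theorem span_range_e : Submodule.span K (Set.range (e K (M := M))) = ⊤ := by
  rw [eq_top_iff]
  rintro b -
  obtain ⟨p, rfl⟩ := Ideal.Quotient.mk_surjective b
  induction p using MvPolynomial.induction_on with
  | C a =>
    have : Ideal.Quotient.mk (axesIdeal K (M + 3)) (C a) = a • e K (0, none) := by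
      simp only [e, ← Algebra.algebraMap_eq_smul_one]
      rfl
    rw [this]
    exact Submodule.smul_mem _ _ (Submodule.subset_span ⟨_, rfl⟩)
  | add p q hp hq => rw [map_add]; exact add_mem hp hq
  | mul_X p i hp =>
    rw [map_mul, mul_comm]
    change y K i * _ ∈ _
    generalize Ideal.Quotient.mk (axesIdeal K (M + 3)) p = b at hp
    induction hp using Submodule.span_induction with
    | mem x hx =>
      obtain ⟨α, rfl⟩ := hx
      obtain ⟨β, h, -⟩ := exists_y_mul_e (K := K) i α
      exact Submodule.subset_span ⟨β, h.symm⟩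
    | zero => simp
    | add a b _ _ ha hb => rw [mul_add]; exact add_mem ha hb
    | smul c a _ ha => rw [mul_smul_comm]; exact Submodule.smul_mem _ _ ha

/-- The restriction map to all lines. -/
def toLines (K : Type*) [CommRing K] (N : ℕ) :
    AxesRing K N →ₐ[K] (Option (Fin N) → Polynomial K) :=
  AlgHom.pi (toLine K)

/-- Functionals on tuples of polynomials whose restrictions to `AxesRing K (M + 3)` are dual to the
basis `e`. -/
def dual (K : Type*) [CommRing K] (M : ℕ) :
    (Option (Fin (M + 3)) → Polynomial K) →ₗ[K] (ℕ × Option (Fin (M + 3)) → K) :=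
  LinearMap.pi fun
    | (d, some i) => Polynomial.lcoeff K (d + 1) ∘ₗ LinearMap.proj (some i)
    | (0, none) => Polynomial.lcoeff K 0 ∘ₗ LinearMap.proj none
    | (d + 1, none) => Polynomial.lcoeff K (d + 2) ∘ₗ
        (LinearMap.proj none - ∑ i, LinearMap.proj (some i))

theorem toLine_some_e_none (j : Fin (M + 3)) (d : ℕ) :
    toLine K (some j) (y K 0 * y K 1 ^ (d + 1)) = 0 := by
  by_cases h : j = 0
  · subst h
    simp
  · simp [h]

theorem dual_toLines_e (α : ℕ × Option (Fin (M + 3))) :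
    dual K M (toLines K _ (e K α)) = Pi.single α 1 := by
  funext β
  match α, β with
  | (d, some i), (d', some i') =>
    simp [dual, toLines, e, Pi.single_apply, ite_pow]
    grind [Polynomial.coeff_zero]
  | (d, some i), (0, none) => simp [dual, toLines, e]
  | (d, some i), (d' + 1, none) => simp [dual, toLines, e, ite_pow]
  | (0, none), (d', some i') => simp [dual, toLines, e, Polynomial.coeff_one]
  | (0, none), (0, none) => simp [dual, toLines, e]
  | (0, none), (d' + 1, none) => simp [dual, toLines, e, Polynomial.coeff_one]
  | (d + 1, none), (d', some i') =>
    have := toLine_some_e_none (K := K) i' d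
    simp_all [dual, toLines, e]
  | (d + 1, none), (0, none) => simp [dual, toLines, e, Polynomial.coeff_X_pow]
  | (d + 1, none), (d' + 1, none) =>
    have := fun i ↦ toLine_some_e_none (K := K) (M := M) i d
    simp_all [dual, toLines, e, Pi.single_apply, Polynomial.coeff_X_pow, ← pow_succ']

/-- The basis `e`. -/
def basis (K : Type*) [CommRing K] (M : ℕ) :
    Module.Basis (ℕ × Option (Fin (M + 3))) K (AxesRing K (M + 3)) :=
  .mk (v := e K)
    (.of_comp (dual K M ∘ₗ (toLines K _).toLinearMap) <| by
      convert Pi.linearIndependent_single_one (ℕ × Option (Fin (M + 3))) K with α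
      exact dual_toLines_e α)
    span_range_e.ge

@[simp] theorem basis_apply (α : ℕ × Option (Fin (M + 3))) : basis K M α = e K α := by
  simp [basis]

theorem toLines_injective : Function.Injective (toLines K (M + 3)) := by
  have key : dual K M ∘ₗ (toLines K _).toLinearMap =
      Finsupp.lcoeFun ∘ₗ (basis K M).repr.toLinearMap := by
    refine (basis K M).ext fun α ↦ ?_
    rw [LinearMap.comp_apply, LinearMap.comp_apply, LinearEquiv.coe_coe, Module.Basis.repr_self,
      basis_apply]
    refine (dual_toLines_e α).trans ?_
    funext β
    simp [Finsupp.single_apply, Pi.single_apply, eq_comm]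
  refine Function.Injective.of_comp (f := dual K M) ?_
  have : Function.Injective (Finsupp.lcoeFun ∘ₗ (basis K M).repr.toLinearMap) :=
    DFunLike.coe_injective.comp (basis K M).repr.injective
  rw [← key] at this
  exact this

/-- A homogeneous parameter, restricting to the square of the coordinate on each line. -/
def param (K : Type*) [CommRing K] (M : ℕ) : AxesRing K (M + 3) :=
  ∑ i, y K i ^ 2 - (M + 2 : ℕ) • (y K 0 * y K 1)

theorem toLines_param : toLines K _ (param K M) = fun _ ↦ Polynomial.X ^ 2 := by
  funext j
  cases j with
  | none =>
    simp only [toLines, param, AlgHom.pi_apply, map_sub, map_sum, map_pow, map_nsmul, map_mul,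
      toLine_none_y, Finset.sum_const, Finset.card_univ, Fintype.card_fin]
    ring
  | some j =>
    have := toLine_some_e_none (K := K) j 0
    simp_all [toLines, param, ite_pow]

theorem y_pow_three (i : Fin (M + 3)) : y K i ^ 3 = param K M * y K i := by
  apply toLines_injective
  rw [map_mul, toLines_param]
  funext j
  cases j with
  | none => simp [toLines]; ring
  | some j => simp [toLines, ite_pow]; split_ifs <;> ring

end CommRing

section Field

variable {K : Type*} [Field K] {M : ℕ}

theorem toLines_aeval_param (p : Polynomial K) :
    toLines K _ (Polynomial.aeval (param K M) p) = fun _ ↦ Polynomial.expand K 2 p := by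
  rw [← Polynomial.aeval_algHom_apply, toLines_param]
  funext j
  rw [Polynomial.aeval_pi_apply₂]
  rfl

theorem flat_aeval_param :
    (Polynomial.aeval (R := K) (param K M)).toRingHom.Flat := by
  algebraize [(Polynomial.aeval (R := K) (param K M)).toRingHom]
  have : Module.IsTorsionFree (Polynomial K) (AxesRing K (M + 3)) := by
    refine ⟨fun p hp a b h ↦ toLines_injective <| funext fun j ↦ ?_⟩
    have hp : Polynomial.expand K 2 p ≠ 0 :=
      (Polynomial.expand_ne_zero two_pos).2 hp.ne_zero
    refine mul_left_cancel₀ hp ?_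
    have : Polynomial.aeval (param K M) p * a = Polynomial.aeval (param K M) p * b := h
    simpa [toLines_aeval_param] using congr_fun (congr_arg (toLines K _) this) j
  change Module.Flat _ _
  infer_instance

theorem isIntegral_aeval_param :
    (Polynomial.aeval (R := K) (param K M)).toRingHom.IsIntegral := by
  intro b
  obtain ⟨p, rfl⟩ := Ideal.Quotient.mk_surjective b
  induction p using MvPolynomial.induction_on with
  | C a =>
    convert RingHom.isIntegralElem_map (Polynomial.aeval (R := K) (param K M)).toRingHom
      (x := Polynomial.C a)
    simp
    rfl
  | add p q hp hq => rw [map_add]; exact hp.add _ hq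
  | mul_X p i hp =>
    rw [map_mul]
    refine hp.mul _ ⟨Polynomial.X ^ 3 - Polynomial.C Polynomial.X * Polynomial.X, ?_, ?_⟩
    · monicity!
    · have := y_pow_three (K := K) i
      simp [y] at *
      simp [this]

end Field

end AxesRing

/-- A ring isomorphic to a polynomial ring over `AxesRing K (M + 3)` is Cohen–Macaulay. -/
theorem isCohenMacaulayRing_of_ringEquiv_axesRing {K A : Type*} [Field K] [CommRing A] {M : ℕ}
    (e : Polynomial (AxesRing K (M + 3)) ≃+* A) : IsCohenMacaulayRing A := by
  have hflat := flat_mapRingHom (AxesRing.flat_aeval_param (K := K) (M := M))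
  have hintegral := isIntegral_mapRingHom (AxesRing.isIntegral_aeval_param (K := K) (M := M))
  generalize Polynomial.mapRingHom (Polynomial.aeval (R := K) (AxesRing.param K M)).toRingHom = f
    at hflat hintegral
  have hflat' : RingHom.Flat (R := Polynomial (Polynomial K)) (S := A) (e.toRingHom.comp f) :=
    hflat.comp (.of_bijective e.bijective)
  have hintegral' : RingHom.IsIntegral (R := Polynomial (Polynomial K)) (A := A) (e.toRingHom.comp f) :=
    hintegral.trans _ _ (RingHom.isIntegral_of_surjective _ e.surjective)
  let : Algebra (Polynomial (Polynomial K)) A := (e.toRingHom.comp f).toAlgebra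
  have : Module.Flat (Polynomial (Polynomial K)) A := hflat'
  have : Algebra.IsIntegral (Polynomial (Polynomial K)) A := ⟨hintegral'⟩
  have : IsNoetherianRing A := isNoetherianRing_of_ringEquiv _ e
  refine isCohenMacaulayRing_of_flat_of_isIntegral (S := Polynomial (Polynomial K)) ?_
  rw [Polynomial.ringKrullDim_of_isNoetherianRing, Polynomial.ringKrullDim_of_isNoetherianRing,
    ringKrullDim_eq_zero_of_field]
  norm_num

theorem IsTableau.spechtPoly_eq (K : Type*) [CommRing K] {n m : ℕ} {T : Fin n → ℕ × ℕ}
    (hT : IsTableau [m, 2] T) {i j k l : Fin n} (hi : T i = (0, 0)) (hj : T j = (1, 0))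
    (hk : T k = (0, 1)) (hl : T l = (1, 1)) :
    spechtPoly K T = (X i - X j) * (X k - X l) := by
  have hik : (i, j) ≠ (k, l) := by
    rintro ⟨⟩
    simp_all
  rw [spechtPoly, ← Finset.prod_pair (f := fun p : Fin n × Fin n ↦ (X p.1 - X p.2 :
    MvPolynomial (Fin n) K)) hik]
  congr 1
  ext ⟨a, b⟩
  obtain ⟨hinj, hmem, -⟩ := hT
  have hb := hmem b
  simp only [Finset.mem_filter, Finset.mem_univ, true_and, Finset.mem_insert,
    Finset.mem_singleton, Prod.mk.injEq]
  constructor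
  · rintro ⟨h1, h2⟩
    have hb1 : (T b).1 = 1 := by simp at hb; lia
    have ha : T a = (0, (T b).2) := Prod.ext (by simp; lia) h1
    have hb2 : (T b).2 < 2 := by simpa [hb1] using hb
    have hb3 : T b = (1, (T b).2) := Prod.ext hb1 rfl
    obtain h | h : (T b).2 = 0 ∨ (T b).2 = 1 := by lia
    · rw [h] at ha hb3
      exact .inl ⟨hinj (ha.trans hi.symm), hinj (hb3.trans hj.symm)⟩
    · rw [h] at ha hb3
      exact .inr ⟨hinj (ha.trans hk.symm), hinj (hb3.trans hl.symm)⟩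
  · rintro (⟨rfl, rfl⟩ | ⟨rfl, rfl⟩) <;> simp [*]

theorem IsTableau.exists_spechtPoly_eq (K : Type*) [CommRing K] {n m : ℕ} {T : Fin n → ℕ × ℕ}
    (hm : 2 ≤ m) (hT : IsTableau [m, 2] T) :
    ∃ i j k l, i ≠ j ∧ i ≠ k ∧ i ≠ l ∧ j ≠ k ∧ j ≠ l ∧ k ≠ l ∧
      spechtPoly K T = (X i - X j) * (X k - X l) := by
  obtain ⟨i, hi⟩ := hT.2.2 0 0 (by simp) (by simp; lia)
  obtain ⟨j, hj⟩ := hT.2.2 1 0 (by simp) (by simp)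
  obtain ⟨k, hk⟩ := hT.2.2 0 1 (by simp) (by simp; lia)
  obtain ⟨l, hl⟩ := hT.2.2 1 1 (by simp) (by simp)
  refine ⟨i, j, k, l, ?_, ?_, ?_, ?_, ?_, ?_, hT.spechtPoly_eq K hi hj hk hl⟩ <;>
  · rintro rfl
    simp_all

theorem exists_isTableau {M : ℕ} {i j k l : Fin (M + 4)} (hij : i ≠ j) (hik : i ≠ k)
    (hil : i ≠ l) (hjk : j ≠ k) (hjl : j ≠ l) (hkl : k ≠ l) :
    ∃ T : Fin (M + 4) → ℕ × ℕ, IsTableau [M + 2, 2] T ∧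
      T i = (0, 0) ∧ T j = (1, 0) ∧ T k = (0, 1) ∧ T l = (1, 1) := by
  let box (m : ℕ) : ℕ × ℕ := if m < 4 then (m % 2, m / 2) else (0, m - 2)
  have hinj : Function.Injective ![i, j, k, l] := by
    intro a b h
    fin_cases a <;> fin_cases b <;> simp_all [eq_comm]
  obtain ⟨σ, hσ⟩ : ∃ σ : Equiv.Perm (Fin (M + 4)),
      ∀ a, σ (![i, j, k, l] a) = Fin.castLE (by lia) a := by
    obtain ⟨σ, hσ⟩ := Equiv.Perm.exists_extending_pair _ _ hinj
      (Fin.castLE_injective (by lia : 4 ≤ M + 4))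
    exact ⟨σ, hσ⟩
  refine ⟨fun a ↦ box (σ a), ⟨fun a b h ↦ σ.injective (Fin.ext ?_), fun a ↦ ?_,
    fun r c hr hc ↦ ?_⟩, ?_, ?_, ?_, ?_⟩
  · simp only [box] at h
    split_ifs at h <;> simp [Prod.ext_iff] at h <;> lia
  · have := (σ a).2
    simp only [box]
    split_ifs
    · obtain h | h : (σ a : ℕ) % 2 = 0 ∨ (σ a : ℕ) % 2 = 1 := by lia
      · simp [h]; lia
      · simp [h]; lia
    · simp; lia
  · have hr2 : r = 0 ∨ r = 1 := by simp at hr; lia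
    have hlt : (if c < 2 then r + 2 * c else c + 2) < M + 4 := by
      rcases hr2 with rfl | rfl <;> simp at hc <;> split_ifs <;> lia
    refine ⟨σ.symm ⟨_, hlt⟩, ?_⟩
    simp only [box, Equiv.apply_symm_apply]
    rcases hr2 with rfl | rfl <;> simp at hc <;> split_ifs <;> simp <;> lia
  · have := hσ 0
    simp_all [box]
  · have := hσ 1
    simp_all [box]
  · have := hσ 2
    simp_all [box]
  · have := hσ 3
    simp_all [box]

theorem sub_mul_sub_mem_spechtIdeal (K : Type*) [CommRing K] {M : ℕ} {i j k l : Fin (M + 4)}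
    (hij : i ≠ j) (hik : i ≠ k) (hil : i ≠ l) (hjk : j ≠ k) (hjl : j ≠ l) :
    (X i - X j) * (X k - X l) ∈ spechtIdeal K (M + 4) [M + 2, 2] := by
  by_cases hkl : k = l
  · simp [hkl]
  obtain ⟨T, hT, hi, hj, hk, hl⟩ := exists_isTableau hij hik hil hjk hjl hkl
  exact Ideal.subset_span ⟨T, hT, (hT.spechtPoly_eq K hi hj hk hl).symm⟩

namespace SpechtQuotient

section CommRing

open AxesRing

variable {K : Type*} [CommRing K] {M : ℕ}

/-- The images of the variables of `MvPolynomial (Fin (M + 4)) K` under the change of coordinates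
to `X 0` and the differences `X (i + 1) - X 0`. -/
def coord (K : Type*) [CommRing K] (M : ℕ) : Fin (M + 4) → Polynomial (AxesRing K (M + 3)) :=
  fun i ↦ Polynomial.X + Polynomial.C ((Fin.cons 0 (y K) : Fin (M + 4) → _) i)

theorem coord_sub_mul_coord_sub {i j k l : Fin (M + 4)}
    (hik : i ≠ k) (hil : i ≠ l) (hjk : j ≠ k) (hjl : j ≠ l) :
    (coord K M i - coord K M j) * (coord K M k - coord K M l) = 0 := by
  have key {i k : Fin (M + 4)} (h : i ≠ k) : (Fin.cons 0 (y K) : Fin (M + 4) → _) i *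
      (Fin.cons 0 (y K) : Fin (M + 4) → _) k = if i = 0 ∨ k = 0 then 0 else y K 0 * y K 1 := by
    cases i using Fin.cases <;> cases k using Fin.cases <;> simp_all
    exact y_mul_y ‹_›
  simp only [coord, add_sub_add_left_eq_sub, ← Polynomial.C_sub, ← Polynomial.C_mul]
  convert Polynomial.C_0
  rw [sub_mul, mul_sub, mul_sub, key hik, key hil, key hjk, key hjl]
  split_ifs <;> grind

/-- The change of coordinates on the ambient polynomial ring. -/
def toPoly (K : Type*) [CommRing K] (M : ℕ) :
    (MvPolynomial (Fin (M + 4)) K ⧸ spechtIdeal K (M + 4) [M + 2, 2]) →ₐ[K]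
      Polynomial (AxesRing K (M + 3)) :=
  Ideal.Quotient.liftₐ _ (aeval (coord K M)) <| by
    intro a ha
    rw [← RingHom.mem_ker]
    revert a
    refine Ideal.span_le.2 ?_
    rintro _ ⟨T, hT, rfl⟩
    obtain ⟨i, j, k, l, -, hik, hil, hjk, hjl, -, h⟩ := hT.exists_spechtPoly_eq K (by lia)
    simp [h, RingHom.mem_ker, coord_sub_mul_coord_sub hik hil hjk hjl]

@[simp] theorem toPoly_mk (p : MvPolynomial (Fin (M + 4)) K) :
    toPoly K M (Ideal.Quotient.mk _ p) = aeval (coord K M) p := rfl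

/-- The inverse of `toPoly` on constants. -/
def ofAxesRing (K : Type*) [CommRing K] (M : ℕ) : AxesRing K (M + 3) →ₐ[K]
    (MvPolynomial (Fin (M + 4)) K ⧸ spechtIdeal K (M + 4) [M + 2, 2]) :=
  Ideal.Quotient.liftₐ _ (aeval fun i ↦ Ideal.Quotient.mk _ (X i.succ - X 0)) <| by
    intro a ha
    rw [← RingHom.mem_ker]
    revert a
    refine Ideal.span_le.2 ?_
    rintro _ ⟨i, k, l, hik, hil, rfl⟩
    simp only [SetLike.mem_coe, RingHom.mem_ker, map_mul, map_sub, aeval_X,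
      sub_sub_sub_cancel_right]
    simp only [← map_mul, ← map_sub]
    exact Ideal.Quotient.eq_zero_iff_mem.2 <| sub_mul_sub_mem_spechtIdeal K (by simp)
      (by simpa using hik) (by simpa using hil) (by simp [eq_comm]) (by simp [eq_comm])

@[simp] theorem ofAxesRing_mk (p : MvPolynomial (Fin (M + 3)) K) :
    ofAxesRing K M (Ideal.Quotient.mk _ p) =
      aeval (fun i ↦ Ideal.Quotient.mk _ (X i.succ - X 0)) p := rfl

/-- The quotient by the Specht ideal is a polynomial ring over `AxesRing`. -/
def equiv (K : Type*) [CommRing K] (M : ℕ) :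
    (MvPolynomial (Fin (M + 4)) K ⧸ spechtIdeal K (M + 4) [M + 2, 2]) ≃ₐ[K]
      Polynomial (AxesRing K (M + 3)) :=
  .ofAlgHom (toPoly K M)
    (Polynomial.aevalTower (ofAxesRing K M) (Ideal.Quotient.mk _ (X 0)))
    (by
      refine Polynomial.algHom_ext'
        (Ideal.Quotient.algHom_ext _ (MvPolynomial.algHom_ext fun i ↦ ?_)) ?_
      · simp [coord]
        rfl
      · simp [coord])
    (by
      refine Ideal.Quotient.algHom_ext _ (MvPolynomial.algHom_ext fun i ↦ ?_)
      cases i using Fin.cases with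
      | zero => simp [coord]
      | succ i => simp [coord, y])

/-- The span of the images of the variables. -/
def linearForms (K : Type*) [CommRing K] (M : ℕ) : Submodule K (Polynomial (AxesRing K (M + 3))) :=
  .span K (Set.range (coord K M))

theorem map_homogeneousSubmodule (m : ℕ) :
    (homogeneousSubmodule (Fin (M + 4)) K m).map (aeval (coord K M)).toLinearMap =
      linearForms K M ^ m := by
  rw [← homogeneousSubmodule_one_pow, Submodule.map_pow, homogeneousSubmodule_one_eq_span_X,
    Submodule.map_span, ← Set.range_comp, linearForms]
  congr! 3
  funext i
  simp

theorem X_mem_linearForms : Polynomial.X ∈ linearForms K M := by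
  have : coord K M 0 ∈ linearForms K M := Submodule.subset_span ⟨0, rfl⟩
  simpa [coord] using this

theorem C_y_mem_linearForms (i : Fin (M + 3)) : Polynomial.C (y K i) ∈ linearForms K M := by
  have : coord K M i.succ ∈ linearForms K M := Submodule.subset_span ⟨_, rfl⟩
  simpa [coord] using sub_mem this X_mem_linearForms

theorem C_e_mem_linearForms_pow (α : ℕ × Option (Fin (M + 3))) :
    Polynomial.C (e K α) ∈ linearForms K M ^ deg α := by
  match α with
  | (0, none) => exact ⟨1, by simp [e]⟩
  | (d + 1, none) =>
    simp only [e, deg, Polynomial.C_mul, Polynomial.C_pow]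
    rw [pow_succ']
    exact Submodule.mul_mem_mul (C_y_mem_linearForms _)
      (Submodule.pow_mem_pow _ (C_y_mem_linearForms _) _)
  | (d, some i) =>
    simp only [e, deg, Polynomial.C_pow]
    exact Submodule.pow_mem_pow _ (C_y_mem_linearForms _) _

/-- The elements of degree `m` of a homogeneous basis of the polynomial ring over `AxesRing`. -/
def degreeFamily (K : Type*) [CommRing K] (M m : ℕ)
    (α : {α : ℕ × Option (Fin (M + 3)) // deg α ≤ m}) :
    Polynomial (AxesRing K (M + 3)) :=
  Polynomial.monomial (m - deg α.1) (e K α.1)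

theorem linearIndependent_degreeFamily (m : ℕ) : LinearIndependent K (degreeFamily K M m) := by
  convert ((basis K M).smulTower (Polynomial.basisMonomials _)).linearIndependent.comp
    (fun α : {α : ℕ × Option (Fin (M + 3)) // deg α ≤ m} ↦ (α.1, m - deg α.1))
    (fun α β h ↦ Subtype.ext (Prod.ext_iff.1 h).1) using 1
  funext α
  simp [degreeFamily, Polynomial.smul_monomial]

theorem monomial_mem_span_degreeFamily {α : ℕ × Option (Fin (M + 3))} {k m : ℕ}
    (h : k + deg α = m) :
    Polynomial.monomial k (e K α) ∈ Submodule.span K (Set.range (degreeFamily K M m)) :=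
  Submodule.subset_span ⟨⟨α, by lia⟩, by simp [degreeFamily, ← h]⟩

theorem linearForms_pow (m : ℕ) :
    linearForms K M ^ m = Submodule.span K (Set.range (degreeFamily K M m)) := by
  apply le_antisymm
  · induction m with
    | zero =>
      rw [pow_zero, Submodule.one_eq_span, Submodule.span_singleton_le_iff_mem]
      exact monomial_mem_span_degreeFamily (α := (0, none)) (k := 0) rfl
    | succ m ih =>
      rw [pow_succ']
      refine (mul_le_mul' le_rfl ih).trans ?_
      rw [linearForms, Submodule.span_mul_span, Submodule.span_le]
      rintro _ ⟨_, ⟨i, rfl⟩, _, ⟨⟨α, hα⟩, rfl⟩, rfl⟩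
      simp only [coord, degreeFamily, add_mul, Polynomial.X_mul_monomial, Polynomial.C_mul_monomial]
      refine add_mem (monomial_mem_span_degreeFamily (by lia)) ?_
      cases i using Fin.cases with
      | zero => simp
      | succ i =>
        obtain ⟨β, hβ, hd⟩ := exists_y_mul_e (K := K) i α
        rw [Fin.cons_succ, hβ]
        exact monomial_mem_span_degreeFamily (by lia)
  · rw [Submodule.span_le]
    rintro _ ⟨⟨α, hα⟩, rfl⟩
    rw [degreeFamily, ← Polynomial.C_mul_X_pow_eq_monomial, SetLike.mem_coe]
    have := Submodule.mul_mem_mul (C_e_mem_linearForms_pow (K := K) α)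
      (Submodule.pow_mem_pow _ X_mem_linearForms (m - deg α))
    rwa [← pow_add, Nat.add_sub_cancel' hα] at this

/-- The index set of `degreeFamily` in positive degree. -/
def degLEEquiv (M m : ℕ) :
    {α : ℕ × Option (Fin (M + 3)) // deg α ≤ m + 1} ≃ Fin (m + 1) × Option (Fin (M + 3)) where
  toFun α := (⟨α.1.1, by
    obtain ⟨⟨_ | d, _ | i⟩, h⟩ := α <;> have := h <;> simp [deg] at this ⊢ <;> lia⟩, α.1.2)
  invFun β := ⟨(β.1, β.2), by
    obtain ⟨⟨_ | d, h⟩, _ | i⟩ := β <;> simp [deg] at h ⊢ <;> lia⟩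
  left_inv _ := rfl
  right_inv _ := rfl

end CommRing

section Field

variable {K : Type*} [Field K]

theorem finrank_map_homogeneousSubmodule (M m : ℕ) :
    Module.finrank K ((homogeneousSubmodule (Fin (M + 4)) K m).map
      (Ideal.Quotient.mkₐ K (spechtIdeal K (M + 4) [M + 2, 2])).toLinearMap) =
    Nat.card {α : ℕ × Option (Fin (M + 3)) // AxesRing.deg α ≤ m} := by
  rw [← LinearEquiv.finrank_map_eq (equiv K M).toLinearEquiv, ← Submodule.map_comp]
  have : (equiv K M).toLinearEquiv.toLinearMap ∘ₗ
      (Ideal.Quotient.mkₐ K (spechtIdeal K (M + 4) [M + 2, 2])).toLinearMap =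
      (aeval (coord K M)).toLinearMap := rfl
  rw [this, map_homogeneousSubmodule, linearForms_pow]
  exact Module.finrank_eq_nat_card_basis (Module.Basis.span (linearIndependent_degreeFamily m))

end Field

end SpechtQuotient

end

/-- Proposition 5.1: for every field `K` and `n ≥ 4`, the ring `R/I^Sp_{(n-2, 2)}` is
Cohen–Macaulay, and its Hilbert series is `(1 + (n-2)t + t²)/(1-t)²`; equivalently, the
`K`-dimension of the degree-`m` component of `R/I^Sp_{(n-2, 2)}` (the image of the space
of homogeneous degree-`m` polynomials in the quotient) is `1` for `m = 0` and `n·m` for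
all `m ≥ 1`. -/
theorem specht_n22_CM_and_Hilbert {K : Type*} [Field K] (n : ℕ) (hn : 4 ≤ n) :
    IsCohenMacaulayRing (MvPolynomial (Fin n) K ⧸ spechtIdeal K n [n - 2, 2]) ∧
      Module.finrank K ((MvPolynomial.homogeneousSubmodule (Fin n) K 0).map
        (Ideal.Quotient.mkₐ K (spechtIdeal K n [n - 2, 2])).toLinearMap) = 1 ∧
      ∀ m : ℕ, 1 ≤ m →
        Module.finrank K ((MvPolynomial.homogeneousSubmodule (Fin n) K m).map
          (Ideal.Quotient.mkₐ K (spechtIdeal K n [n - 2, 2])).toLinearMap) = n * m := by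
  obtain ⟨M, rfl⟩ : ∃ M, n = M + 4 := ⟨n - 4, by lia⟩
  rw [show M + 4 - 2 = M + 2 by lia]
  refine ⟨isCohenMacaulayRing_of_ringEquiv_axesRing (SpechtQuotient.equiv K M).symm.toRingEquiv,
    ?_, fun m hm ↦ ?_⟩
  · rw [SpechtQuotient.finrank_map_homogeneousSubmodule, Nat.card_eq_one_iff_unique]
    exact ⟨⟨fun α β ↦ Subtype.ext <| (AxesRing.eq_of_deg_le_zero α.2).trans
      (AxesRing.eq_of_deg_le_zero β.2).symm⟩, ⟨(0, none), le_rfl⟩⟩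
  · obtain ⟨m, rfl⟩ := Nat.exists_eq_add_of_le' hm
    rw [SpechtQuotient.finrank_map_homogeneousSubmodule,
      Nat.card_congr (SpechtQuotient.degLEEquiv M m)]
    simp
    ring
end
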